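/- Suppose the real eigenvalue sequence satisfies 0 < E_1 < E_2 < ⋯ and the two-sided gap condition c_H·|m−n|/max{m,n}^{2γ} ≤ |E_m − E_n| ≤ C_H·|m−n|/max{m,n}^{2γ} for all m,n ≥ 1, for some γ ∈ (0,1/2) and constants 0 < c_H ≤ C_H. Let p > 2, let q be a natural number with q < p − 1, and let T > 0. Then there exists ε > 0 such that for every T-periodic, strongly C¹ family V(t) of bounded self-adjoint operators with ‖V‖_{p,γ} ≤ ε there exist: a T-periodic, strongly C¹ family J(t) of unitary operators on ℋ; a bounded self-adjoint diagonal operator A; and a T-periodic, strongly C¹ family B(t) of bounded self-adjoint operators with ‖B‖_{p−q,(q+1)γ} < ∞; such that for every t the operator J(t)* maps Dom(H) onto Dom(H) and for every ψ ∈ Dom(H): (H+V(t))ψ = J(t)(H+A+B(t))J(t)*ψ + i·J̇(t)J(t)*ψ, where J̇(t) denotes the strong derivative of J at t. -/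

import Mathlib

noncomputable section

open ContinuousLinearMap

variable {𝓗 : Type*} [NormedAddCommGroup 𝓗] [InnerProductSpace ℂ 𝓗] [CompleteSpace 𝓗]

/-- `⟨x⟩ := max {1, |x|}`. -/
def jap (x : ℝ) : ℝ := max 1 |x|

/-- `(Pₙ)_{n≥1}` is a family of mutually orthogonal nonzero orthogonal projections
with `Σₙ Pₙ = I` in the strong sense. -/
def ProjFamily (P : ℕ+ → 𝓗 →L[ℂ] 𝓗) : Prop :=
  (∀ n, IsSelfAdjoint (P n)) ∧ (∀ n, (P n).comp (P n) = P n) ∧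
  (∀ m n, m ≠ n → (P m).comp (P n) = 0) ∧ (∀ n, P n ≠ 0) ∧
  (∀ ψ : 𝓗, HasSum (fun n => P n ψ) ψ)

/-- The quantity `⟨m-n⟩^p · max{m,n}^(2δ) · ‖Pₘ A Pₙ‖`; the norm `‖A‖_{p,δ}` is its
supremum over `m, n ≥ 1`. -/
def wnorm (P : ℕ+ → 𝓗 →L[ℂ] 𝓗) (p δ : ℝ) (A : 𝓗 →L[ℂ] 𝓗) (m n : ℕ+) : ℝ :=
  jap (((m : ℕ) : ℝ) - ((n : ℕ) : ℝ)) ^ p * (((max m n : ℕ+) : ℕ) : ℝ) ^ (2 * δ) *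
    ‖(P m).comp (A.comp (P n))‖

/-- `A` is diagonal with respect to the family `P`. -/
def IsDiag (P : ℕ+ → 𝓗 →L[ℂ] 𝓗) (A : 𝓗 →L[ℂ] 𝓗) : Prop :=
  ∀ m n, m ≠ n → (P m).comp (A.comp (P n)) = 0

/-- `Dom(H) = {ψ : Σₙ Eₙ²‖Pₙψ‖² < ∞}`. -/
def HDom (P : ℕ+ → 𝓗 →L[ℂ] 𝓗) (E : ℕ+ → ℝ) : Set 𝓗 :=
  {ψ | Summable fun n => (E n) ^ 2 * ‖P n ψ‖ ^ 2}

/-- The form domain `Q_H = {ψ : Σₙ Eₙ‖Pₙψ‖² < ∞}`. -/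
def QDom (P : ℕ+ → 𝓗 →L[ℂ] 𝓗) (E : ℕ+ → ℝ) : Set 𝓗 :=
  {ψ | Summable fun n => E n * ‖P n ψ‖ ^ 2}

/-- `h = Hψ`, i.e. `h = Σₙ Eₙ Pₙ ψ`. -/
def IsHSum (P : ℕ+ → 𝓗 →L[ℂ] 𝓗) (E : ℕ+ → ℝ) (ψ h : 𝓗) : Prop :=
  HasSum (fun n => (E n : ℂ) • P n ψ) h

/-- `U` is unitary. -/
def IsUnitaryOp (U : 𝓗 →L[ℂ] 𝓗) : Prop := U * star U = 1 ∧ star U * U = 1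

/-- A family of bounded operators which is `C¹` in the strong sense. -/
def StrongC1 (V : ℝ → 𝓗 →L[ℂ] 𝓗) : Prop := ∀ ψ : 𝓗, ContDiff ℝ 1 fun t => V t ψ

/-- `U(t,s)` is a propagator for `H + V(t)`. -/
def IsPropagator (P : ℕ+ → 𝓗 →L[ℂ] 𝓗) (E : ℕ+ → ℝ) (V : ℝ → 𝓗 →L[ℂ] 𝓗)
    (U : ℝ → ℝ → 𝓗 →L[ℂ] 𝓗) : Prop :=
  (∀ t s, IsUnitaryOp (U t s)) ∧
  (∀ ψ : 𝓗, Continuous fun ts : ℝ × ℝ => U ts.1 ts.2 ψ) ∧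
  (∀ t, U t t = 1) ∧
  (∀ t s r, (U t s).comp (U s r) = U t r) ∧
  (∀ t s, ⇑(U t s) '' HDom P E = HDom P E) ∧
  (∀ s : ℝ, ∀ ψ ∈ HDom P E, ∀ t : ℝ, ∃ d : 𝓗,
    HasDerivAt (fun τ => U τ s ψ) d t ∧
    ∀ h : 𝓗, IsHSum P E (U t s ψ) h → Complex.I • d = h + V t (U t s ψ))

/-- The Riemann zeta function `ζ(s) = Σ_{n≥1} n^{-s}` (for real `s > 1`). -/
def rzeta (s : ℝ) : ℝ := ∑' n : ℕ+, (((n : ℕ) : ℝ) ^ s)⁻¹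

/-- The constant `C_p = 2^(p+1) (1 + 2 ζ(p-1))`. -/
def Cconst (p : ℝ) : ℝ := 2 ^ (p + 1) * (1 + 2 * rzeta (p - 1))


/-! ### Real weights -/

/-- The inverse weight. -/
def wt (r δ : ℝ) (m n : ℕ+) : ℝ :=
  (jap (((m : ℕ) : ℝ) - ((n : ℕ) : ℝ)) ^ r * (((max m n : ℕ+) : ℕ) : ℝ) ^ (2 * δ))⁻¹

/-- `Σ_{d ∈ ℤ} ⟨d⟩^{-c}`. -/
def Zsum (c : ℝ) : ℝ := ∑' d : ℤ, jap (d : ℝ) ^ (-c)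

lemma jap_one_le (x : ℝ) : 1 ≤ jap x := le_max_left _ _

lemma jap_pos (x : ℝ) : 0 < jap x := lt_of_lt_of_le one_pos (jap_one_le x)

lemma abs_le_jap (x : ℝ) : |x| ≤ jap x := le_max_right _ _

lemma jap_neg (x : ℝ) : jap (-x) = jap x := by simp [jap]

lemma jap_tri (x y : ℝ) : jap (x + y) ≤ jap x + jap y := by
  have h1 := jap_one_le x
  have h2 := jap_one_le y
  have h3 := abs_le_jap x
  have h4 := abs_le_jap y
  exact max_le (by linarith) ((abs_add_le x y).trans (by linarith))

lemma pcast_one_le (n : ℕ+) : (1 : ℝ) ≤ ((n : ℕ) : ℝ) := by exact_mod_cast n.2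

lemma max_cast (m n : ℕ+) :
    (((max m n : ℕ+) : ℕ) : ℝ) = max ((m : ℕ) : ℝ) ((n : ℕ) : ℝ) := by
  rcases le_total m n with h | h
  · rw [max_eq_right h, max_eq_right]; exact_mod_cast h
  · rw [max_eq_left h, max_eq_left]; exact_mod_cast h

lemma wt_pos (r δ : ℝ) (m n : ℕ+) : 0 < wt r δ m n := by
  have h1 := jap_pos (((m : ℕ) : ℝ) - ((n : ℕ) : ℝ))
  have h2 := pcast_one_le (max m n)
  unfold wt
  positivity

lemma wt_symm (r δ : ℝ) (m n : ℕ+) : wt r δ m n = wt r δ n m := by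
  unfold wt
  rw [max_comm m n, ← jap_neg, neg_sub]

lemma jap_sub_le_max (m n : ℕ+) :
    jap (((m : ℕ) : ℝ) - ((n : ℕ) : ℝ)) ≤ (((max m n : ℕ+) : ℕ) : ℝ) := by
  have h1 := pcast_one_le m
  have h2 := pcast_one_le n
  rw [max_cast]
  refine max_le (le_max_of_le_left h1) ?_
  rw [abs_le]
  constructor
  · have := le_max_right ((m : ℕ) : ℝ) ((n : ℕ) : ℝ); linarith
  · have := le_max_left ((m : ℕ) : ℝ) ((n : ℕ) : ℝ); linarith

/-- Embedding between classes. -/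
lemma wt_le (a α b β : ℝ) (h1 : β ≤ α) (h2 : b ≤ a + 2 * (α - β)) (m n : ℕ+) :
    wt a α m n ≤ wt b β m n := by
  unfold wt
  set x := jap (((m : ℕ) : ℝ) - ((n : ℕ) : ℝ)) with hx
  set M := (((max m n : ℕ+) : ℕ) : ℝ) with hM
  have hx1 : 1 ≤ x := jap_one_le _
  have hM1 : 1 ≤ M := pcast_one_le _
  have hxM : x ≤ M := jap_sub_le_max m n
  have hx0 : 0 < x := by linarith
  have hM0 : 0 < M := by linarith
  apply inv_anti₀ (by positivity)
  calc x ^ b * M ^ (2 * β) ≤ x ^ (a + 2 * (α - β)) * M ^ (2 * β) := by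
        gcongr
    _ = x ^ a * x ^ (2 * (α - β)) * M ^ (2 * β) := by rw [Real.rpow_add hx0]
    _ ≤ x ^ a * M ^ (2 * (α - β)) * M ^ (2 * β) := by
        gcongr
    _ = x ^ a * M ^ (2 * α) := by
        rw [mul_assoc, ← Real.rpow_add hM0]; ring_nf

lemma wt_le_jap (a α : ℝ) (hα : 0 ≤ α) (m n : ℕ+) :
    wt a α m n ≤ jap (((m : ℕ) : ℝ) - ((n : ℕ) : ℝ)) ^ (-a) := by
  have := wt_le a α a 0 hα (by linarith) m n
  refine this.trans (le_of_eq ?_)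
  unfold wt
  rw [Real.rpow_neg (jap_pos _).le]
  simp

lemma summable_jap (c : ℝ) (hc : 1 < c) : Summable fun d : ℤ => jap (d : ℝ) ^ (-c) := by
  have h1 := Real.summable_abs_int_rpow hc
  have h2 : Summable fun d : ℤ => if d = 0 then (1 : ℝ) else 0 :=
    (hasSum_ite_eq (0 : ℤ) (1 : ℝ)).summable
  refine Summable.of_nonneg_of_le (fun d => (Real.rpow_pos_of_pos (jap_pos _) _).le) ?_
    (h1.add h2)
  intro d
  by_cases hd : d = 0
  · subst hd
    simp only [Int.cast_zero, abs_zero, if_true]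
    have : jap 0 = 1 := by simp [jap]
    rw [this, Real.one_rpow]
    have : 0 ≤ (0 : ℝ) ^ (-c) := Real.rpow_nonneg le_rfl _
    linarith
  · have h3 : jap (d : ℝ) = |(d : ℝ)| := by
      unfold jap
      apply max_eq_right
      have : (1 : ℤ) ≤ |d| := Int.one_le_abs hd
      exact_mod_cast this
    rw [h3, if_neg hd, add_zero]

lemma Zsum_pos (c : ℝ) (hc : 1 < c) : 0 < Zsum c :=
  (summable_jap c hc).tsum_pos (fun d => (Real.rpow_pos_of_pos (jap_pos _) _).le) 0
    (Real.rpow_pos_of_pos (jap_pos _) _)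

lemma inj_sub (m : ℕ+) : Function.Injective fun k : ℕ+ => ((m : ℕ) : ℤ) - ((k : ℕ) : ℤ) := by
  intro a b h
  have : (a : ℕ) = (b : ℕ) := by
    simp only at h; omega
  exact PNat.coe_injective this

lemma row_summable (c : ℝ) (hc : 1 < c) (m : ℕ+) :
    Summable fun k : ℕ+ => jap (((m : ℕ) : ℝ) - ((k : ℕ) : ℝ)) ^ (-c) := by
  have := (summable_jap c hc).comp_injective (inj_sub m)
  refine this.congr fun k => ?_
  simp

lemma row_tsum_le (c : ℝ) (hc : 1 < c) (m : ℕ+) :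
    ∑' k : ℕ+, jap (((m : ℕ) : ℝ) - ((k : ℕ) : ℝ)) ^ (-c) ≤ Zsum c := by
  have := tsum_comp_le_tsum_of_inj (summable_jap c hc)
    (fun d => (Real.rpow_pos_of_pos (jap_pos _) _).le) (inj_sub m)
  refine le_trans (le_of_eq ?_) this
  congr 1
  ext k
  simp

/-- Pointwise inequality behind the product estimate. -/
lemma wt_mul_le (a α b β c α' β' θ : ℝ) (hα' : 0 ≤ α') (hβ' : 0 ≤ β') (hθ : 0 ≤ θ)
    (h1 : α' + θ ≤ α) (h2 : β' + θ ≤ β) (ha : c + 2 * β' ≤ a) (hb : c + 2 * α' ≤ b)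
    (hc : 0 ≤ c) (m k n : ℕ+) :
    wt a α m k * wt b β k n ≤
      (2 ^ c * 2 ^ (2 * α') * 2 ^ (2 * β')) * wt c (α' + β' + θ) m n *
      (jap (((m : ℕ) : ℝ) - ((k : ℕ) : ℝ)) ^ (-c) + jap (((n : ℕ) : ℝ) - ((k : ℕ) : ℝ)) ^ (-c)) := by
  have hsym : jap (((n : ℕ) : ℝ) - ((k : ℕ) : ℝ)) = jap (((k : ℕ) : ℝ) - ((n : ℕ) : ℝ)) := by
    rw [← jap_neg]; congr 1; ring
  have htri := jap_tri (((m : ℕ) : ℝ) - ((k : ℕ) : ℝ)) (((k : ℕ) : ℝ) - ((n : ℕ) : ℝ))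
  rw [sub_add_sub_cancel] at htri
  have e1 := abs_le_jap (((m : ℕ) : ℝ) - ((k : ℕ) : ℝ))
  have e2 := abs_le_jap (((k : ℕ) : ℝ) - ((n : ℕ) : ℝ))
  unfold wt
  rw [hsym]
  have hj1 := jap_one_le (((m : ℕ) : ℝ) - ((k : ℕ) : ℝ))
  have hj2 := jap_one_le (((k : ℕ) : ℝ) - ((n : ℕ) : ℝ))
  have hj := jap_one_le (((m : ℕ) : ℝ) - ((n : ℕ) : ℝ))
  have hM1 := pcast_one_le (max m k)
  have hM2 := pcast_one_le (max k n)
  have hM := pcast_one_le (max m n)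
  have f1 := (le_abs_self (((m : ℕ) : ℝ) - ((k : ℕ) : ℝ))).trans e1
  have f2 := (neg_abs_le (((k : ℕ) : ℝ) - ((n : ℕ) : ℝ)))
  have pm := pcast_one_le m
  have pk := pcast_one_le k
  have pn := pcast_one_le n
  have hk1 : ((k : ℕ) : ℝ) ≤ (((max m k : ℕ+) : ℕ) : ℝ) := by rw [max_cast]; exact le_max_right _ _
  have hm1 : ((m : ℕ) : ℝ) ≤ (((max m k : ℕ+) : ℕ) : ℝ) := by rw [max_cast]; exact le_max_left _ _
  have hk2 : ((k : ℕ) : ℝ) ≤ (((max k n : ℕ+) : ℕ) : ℝ) := by rw [max_cast]; exact le_max_left _ _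
  have hn2 : ((n : ℕ) : ℝ) ≤ (((max k n : ℕ+) : ℕ) : ℝ) := by rw [max_cast]; exact le_max_right _ _
  have hMmn : (((max m n : ℕ+) : ℕ) : ℝ) = max ((m : ℕ) : ℝ) ((n : ℕ) : ℝ) := max_cast m n
  generalize jap (((m : ℕ) : ℝ) - ((k : ℕ) : ℝ)) = j1 at *
  generalize jap (((k : ℕ) : ℝ) - ((n : ℕ) : ℝ)) = j2 at *
  generalize jap (((m : ℕ) : ℝ) - ((n : ℕ) : ℝ)) = j at *
  generalize (((max m k : ℕ+) : ℕ) : ℝ) = M1 at *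
  generalize (((max k n : ℕ+) : ℕ) : ℝ) = M2 at *
  generalize (((max m n : ℕ+) : ℕ) : ℝ) = M at *
  have g1 : M ≤ 2 * (M1 * j2) := by
    rw [hMmn]; refine max_le (by nlinarith) (by nlinarith)
  have g2 : M ≤ 2 * (M2 * j1) := by
    rw [hMmn]; refine max_le (by nlinarith) (by nlinarith)
  have g3 : M ≤ M1 * M2 := by
    rw [hMmn]; refine max_le (by nlinarith) (by nlinarith)
  have j1p : 0 < j1 := by linarith
  have j2p : 0 < j2 := by linarith
  have jp : 0 < j := by linarith
  have M1p : 0 < M1 := by linarith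
  have M2p : 0 < M2 := by linarith
  have Mp : 0 < M := by linarith
  have k1 : j ^ c ≤ 2 ^ c * (j1 ^ c * j2 ^ c) * (j1 ^ (-c) + j2 ^ (-c)) := by
    have : j ≤ 2 * max j1 j2 := by
      have := le_max_left j1 j2
      have := le_max_right j1 j2
      linarith
    have h5 : j ^ c ≤ (2 * max j1 j2) ^ c := Real.rpow_le_rpow jp.le this hc
    rw [Real.mul_rpow (by norm_num) (by positivity)] at h5
    have h6 : (max j1 j2) ^ c ≤ j1 ^ c + j2 ^ c := by
      have p1 : 0 < j1 ^ c := by positivity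
      have p2 : 0 < j2 ^ c := by positivity
      rcases max_cases j1 j2 with ⟨h, _⟩ | ⟨h, _⟩ <;> rw [h] <;> linarith
    have h7 : (j1 ^ c * j2 ^ c) * (j1 ^ (-c) + j2 ^ (-c)) = j1 ^ c + j2 ^ c := by
      rw [Real.rpow_neg j1p.le, Real.rpow_neg j2p.le]
      field_simp
      ring
    rw [mul_assoc, h7]
    refine h5.trans ?_
    gcongr
  have k2 : M ^ (2 * (α' + β' + θ)) ≤ (2 ^ (2 * α') * 2 ^ (2 * β')) *
      (M1 ^ (2 * α) * M2 ^ (2 * β) * (j2 ^ (2 * α') * j1 ^ (2 * β'))) := by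
    have e : 2 * (α' + β' + θ) = 2 * α' + 2 * β' + 2 * θ := by ring
    rw [e, Real.rpow_add Mp, Real.rpow_add Mp]
    have l1 : M ^ (2 * α') ≤ 2 ^ (2 * α') * (M1 ^ (2 * α') * j2 ^ (2 * α')) := by
      rw [← Real.mul_rpow M1p.le j2p.le, ← Real.mul_rpow (by norm_num) (by positivity)]
      exact Real.rpow_le_rpow Mp.le g1 (by linarith)
    have l2 : M ^ (2 * β') ≤ 2 ^ (2 * β') * (M2 ^ (2 * β') * j1 ^ (2 * β')) := by
      rw [← Real.mul_rpow M2p.le j1p.le, ← Real.mul_rpow (by norm_num) (by positivity)]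
      exact Real.rpow_le_rpow Mp.le g2 (by linarith)
    have l3 : M ^ (2 * θ) ≤ M1 ^ (2 * θ) * M2 ^ (2 * θ) := by
      rw [← Real.mul_rpow M1p.le M2p.le]
      exact Real.rpow_le_rpow Mp.le g3 (by linarith)
    have l4 : M1 ^ (2 * α') * M1 ^ (2 * θ) ≤ M1 ^ (2 * α) := by
      rw [← Real.rpow_add M1p]
      exact Real.rpow_le_rpow_of_exponent_le hM1 (by linarith)
    have l5 : M2 ^ (2 * β') * M2 ^ (2 * θ) ≤ M2 ^ (2 * β) := by
      rw [← Real.rpow_add M2p]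
      exact Real.rpow_le_rpow_of_exponent_le hM2 (by linarith)
    calc M ^ (2 * α') * M ^ (2 * β') * M ^ (2 * θ)
        ≤ (2 ^ (2 * α') * (M1 ^ (2 * α') * j2 ^ (2 * α'))) *
          (2 ^ (2 * β') * (M2 ^ (2 * β') * j1 ^ (2 * β'))) * (M1 ^ (2 * θ) * M2 ^ (2 * θ)) := by
          gcongr
      _ = (2 ^ (2 * α') * 2 ^ (2 * β')) * ((M1 ^ (2 * α') * M1 ^ (2 * θ)) *
          (M2 ^ (2 * β') * M2 ^ (2 * θ)) * (j2 ^ (2 * α') * j1 ^ (2 * β'))) := by ring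
      _ ≤ _ := by gcongr
  have k3 : j1 ^ c * j1 ^ (2 * β') ≤ j1 ^ a := by
    rw [← Real.rpow_add j1p]
    exact Real.rpow_le_rpow_of_exponent_le hj1 (by linarith)
  have k4 : j2 ^ c * j2 ^ (2 * α') ≤ j2 ^ b := by
    rw [← Real.rpow_add j2p]
    exact Real.rpow_le_rpow_of_exponent_le hj2 (by linarith)
  have main : j ^ c * M ^ (2 * (α' + β' + θ)) ≤
      (2 ^ c * 2 ^ (2 * α') * 2 ^ (2 * β')) * ((j1 ^ a * M1 ^ (2 * α)) * (j2 ^ b * M2 ^ (2 * β))) *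
      (j1 ^ (-c) + j2 ^ (-c)) := by
    calc j ^ c * M ^ (2 * (α' + β' + θ)) ≤
        (2 ^ c * (j1 ^ c * j2 ^ c) * (j1 ^ (-c) + j2 ^ (-c))) * ((2 ^ (2 * α') * 2 ^ (2 * β')) *
      (M1 ^ (2 * α) * M2 ^ (2 * β) * (j2 ^ (2 * α') * j1 ^ (2 * β')))) := by gcongr
      _ = (2 ^ c * 2 ^ (2 * α') * 2 ^ (2 * β')) * (((j1 ^ c * j1 ^ (2 * β')) * M1 ^ (2 * α)) *
        ((j2 ^ c * j2 ^ (2 * α')) * M2 ^ (2 * β))) * (j1 ^ (-c) + j2 ^ (-c)) := by ring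
      _ ≤ _ := by gcongr
  rw [← mul_inv]
  have q1 : 0 < (j1 ^ a * M1 ^ (2 * α)) * (j2 ^ b * M2 ^ (2 * β)) := by positivity
  have q2 : 0 < j ^ c * M ^ (2 * (α' + β' + θ)) := by positivity
  rw [inv_le_iff_one_le_mul₀ q1]
  calc (1 : ℝ) = (j ^ c * M ^ (2 * (α' + β' + θ))) * (j ^ c * M ^ (2 * (α' + β' + θ)))⁻¹ := by
        rw [mul_inv_cancel₀ q2.ne']
    _ ≤ ((2 ^ c * 2 ^ (2 * α') * 2 ^ (2 * β')) * ((j1 ^ a * M1 ^ (2 * α)) * (j2 ^ b * M2 ^ (2 * β))) *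
      (j1 ^ (-c) + j2 ^ (-c))) * (j ^ c * M ^ (2 * (α' + β' + θ)))⁻¹ := by gcongr
    _ = _ := by ring

/-- The product constant. -/
def Mc (c α' β' : ℝ) : ℝ := (2 ^ c * 2 ^ (2 * α') * 2 ^ (2 * β')) * (2 * Zsum c)

lemma Mc_pos (c α' β' : ℝ) (hc : 1 < c) : 0 < Mc c α' β' := by
  have := Zsum_pos c hc
  unfold Mc
  positivity

lemma wt_conv (a α b β c α' β' θ : ℝ) (hα' : 0 ≤ α') (hβ' : 0 ≤ β') (hθ : 0 ≤ θ)
    (h1 : α' + θ ≤ α) (h2 : β' + θ ≤ β) (ha : c + 2 * β' ≤ a) (hb : c + 2 * α' ≤ b)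
    (hc : 1 < c) (m n : ℕ+) :
    Summable (fun k => wt a α m k * wt b β k n) ∧
      ∑' k, wt a α m k * wt b β k n ≤ Mc c α' β' * wt c (α' + β' + θ) m n := by
  have hp := fun k => wt_mul_le a α b β c α' β' θ hα' hβ' hθ h1 h2 ha hb (by linarith) m k n
  have hs := ((row_summable c hc m).add (row_summable c hc n)).mul_left
    ((2 ^ c * 2 ^ (2 * α') * 2 ^ (2 * β')) * wt c (α' + β' + θ) m n)
  have hS := Summable.of_nonneg_of_le
    (fun k => (mul_pos (wt_pos a α m k) (wt_pos b β k n)).le) hp hs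
  refine ⟨hS, ?_⟩
  refine (hS.tsum_le_tsum hp hs).trans ?_
  rw [tsum_mul_left, (row_summable c hc m).tsum_add (row_summable c hc n)]
  have r1 := row_tsum_le c hc m
  have r2 := row_tsum_le c hc n
  have := wt_pos c (α' + β' + θ) m n
  unfold Mc
  calc _ ≤ (2 ^ c * 2 ^ (2 * α') * 2 ^ (2 * β')) * wt c (α' + β' + θ) m n * (Zsum c + Zsum c) := by
        gcongr
    _ = _ := by ring

set_option linter.unusedSectionVars false
set_option linter.unusedVariables false

/-! ### Block calculus -/

/-- Class predicate: `‖P_m A P_n‖ ≤ b ⟨m-n⟩^{-r} max(m,n)^{-2δ}`. -/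
def Cls (P : ℕ+ → 𝓗 →L[ℂ] 𝓗) (r δ b : ℝ) (A : 𝓗 →L[ℂ] 𝓗) : Prop :=
  ∀ m n, ‖P m * A * P n‖ ≤ b * wt r δ m n

lemma cls_of_wnorm {P : ℕ+ → 𝓗 →L[ℂ] 𝓗} {r δ b : ℝ} {A : 𝓗 →L[ℂ] 𝓗} :
    (∀ m n, wnorm P r δ A m n ≤ b) ↔ Cls P r δ b A := by
  refine forall_congr' fun m => forall_congr' fun n => ?_
  have h1 := jap_pos (((m : ℕ) : ℝ) - ((n : ℕ) : ℝ))
  have h2 := pcast_one_le (max m n)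
  unfold wnorm wt
  have e : (P m).comp (A.comp (P n)) = P m * A * P n := by
    rw [mul_assoc]; rfl
  rw [e, ← div_eq_mul_inv, le_div_iff₀ (by positivity), mul_comm]

section ops
variable {P : ℕ+ → 𝓗 →L[ℂ] 𝓗}

lemma PF.idem (hP : ProjFamily P) (n : ℕ+) : P n * P n = P n := hP.2.1 n
lemma PF.orth (hP : ProjFamily P) {m n : ℕ+} (h : m ≠ n) : P m * P n = 0 := hP.2.2.1 m n h
lemma PF.star (hP : ProjFamily P) (n : ℕ+) : star (P n) = P n := hP.1 n
lemma PF.sum (hP : ProjFamily P) (ψ : 𝓗) : HasSum (fun n => P n ψ) ψ := hP.2.2.2.2 ψ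

lemma PF.inner (hP : ProjFamily P) (n : ℕ+) (x y : 𝓗) :
    inner ℂ (P n x) y = inner ℂ x (P n y) := by
  conv_lhs => rw [← PF.star hP n]
  rw [ContinuousLinearMap.star_eq_adjoint, ContinuousLinearMap.adjoint_inner_left]

lemma PF.apply_idem (hP : ProjFamily P) (n : ℕ+) (x : 𝓗) : P n (P n x) = P n x :=
  congrArg (fun A : 𝓗 →L[ℂ] 𝓗 => A x) (PF.idem hP n)

lemma PF.sq_sum (hP : ProjFamily P) (ψ : 𝓗) :
    HasSum (fun n => ‖P n ψ‖ ^ 2) (‖ψ‖ ^ 2) := by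
  have h := (PF.sum hP ψ).mapL (innerSL ℂ ψ)
  have h2 := h.mapL Complex.reCLM
  convert h2 using 1
  · ext n
    simp only [innerSL_apply_apply, Complex.reCLM_apply]
    rw [← PF.apply_idem hP n ψ, ← PF.inner hP n, PF.apply_idem hP n ψ]
    rw [inner_self_eq_norm_sq_to_K]
    norm_cast
  · simp only [innerSL_apply_apply, Complex.reCLM_apply]
    rw [inner_self_eq_norm_sq_to_K]
    norm_cast

lemma PF.norm_apply_le (hP : ProjFamily P) (n : ℕ+) (ψ : 𝓗) : ‖P n ψ‖ ≤ ‖ψ‖ := by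
  have h := PF.sq_sum hP ψ
  have h1 : ‖P n ψ‖ ^ 2 ≤ ‖ψ‖ ^ 2 := le_hasSum h n (fun _ _ => by positivity)
  exact (sq_le_sq₀ (norm_nonneg _) (norm_nonneg _)).1 h1

lemma PF.norm_le (hP : ProjFamily P) (n : ℕ+) : ‖P n‖ ≤ 1 :=
  ContinuousLinearMap.opNorm_le_bound _ zero_le_one
    (fun ψ => by rw [one_mul]; exact PF.norm_apply_le hP n ψ)

lemma PF.ext_left (hP : ProjFamily P) {x y : 𝓗} (h : ∀ m, P m x = P m y) : x = y :=
  (PF.sum hP x).unique (by simpa only [h] using PF.sum hP y)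

/-- An operator is determined by its blocks. -/
lemma PF.ext (hP : ProjFamily P) {A B : 𝓗 →L[ℂ] 𝓗}
    (h : ∀ m n, P m * A * P n = P m * B * P n) : A = B := by
  ext ψ
  refine PF.ext_left hP fun m => ?_
  have h1 := ((PF.sum hP ψ).mapL A).mapL (P m)
  have h2 := ((PF.sum hP ψ).mapL B).mapL (P m)
  refine h1.unique ?_
  convert h2 using 1
  ext n
  exact congrArg (fun A : 𝓗 →L[ℂ] 𝓗 => A ψ) (h m n)

lemma orth_norm_sum {v : ℕ+ → 𝓗} (ho : ∀ i j, i ≠ j → inner ℂ (v i) (v j) = 0) :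
    (∀ s : Finset ℕ+, ‖∑ i ∈ s, v i‖ ^ 2 = ∑ i ∈ s, ‖v i‖ ^ 2) ∧
    ((Summable fun i => ‖v i‖ ^ 2) → Summable v) := by
  have hV : OrthogonalFamily ℂ (fun i => (Submodule.span ℂ {v i} : Submodule ℂ 𝓗))
      (fun i => (Submodule.span ℂ {v i}).subtypeₗᵢ) := by
    intro i j hij x y
    obtain ⟨a, ha⟩ := Submodule.mem_span_singleton.1 x.2
    obtain ⟨b, hb⟩ := Submodule.mem_span_singleton.1 y.2
    simp only [Submodule.coe_subtypeₗᵢ, Submodule.coe_subtype]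
    rw [← ha, ← hb, inner_smul_left, inner_smul_right, ho i j hij]
    simp
  let f : ∀ i, (Submodule.span ℂ {v i} : Submodule ℂ 𝓗) :=
    fun i => ⟨v i, Submodule.mem_span_singleton_self _⟩
  refine ⟨fun s => ?_, fun h => ?_⟩
  · exact hV.norm_sum f s
  · exact (hV.summable_iff_norm_sq_summable f).2 h

/-- Sum of operators with orthogonal ranges and orthogonal initial spaces. -/
lemma exists_orth_sum (hP : ProjFamily P) (b : ℕ+ → 𝓗 →L[ℂ] 𝓗) (c : ℝ) (hc : 0 ≤ c)
    (ho : ∀ i j, i ≠ j → star (b i) * b j = 0) (hb : ∀ i, b i * P i = b i)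
    (hn : ∀ i, ‖b i‖ ≤ c) :
    ∃ S : 𝓗 →L[ℂ] 𝓗, ‖S‖ ≤ c ∧ ∀ ψ, HasSum (fun i => b i ψ) (S ψ) := by
  have hbP : ∀ i ψ, b i (P i ψ) = b i ψ := fun i ψ =>
    congrArg (fun A : 𝓗 →L[ℂ] 𝓗 => A ψ) (hb i)
  have hle : ∀ ψ i, ‖b i ψ‖ ^ 2 ≤ c ^ 2 * ‖P i ψ‖ ^ 2 := by
    intro ψ i
    rw [← mul_pow, ← hbP i ψ]
    gcongr
    exact (b i).le_of_opNorm_le (hn i) _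
  have hor : ∀ ψ i j, i ≠ j → inner ℂ (b i ψ) (b j ψ) = 0 := by
    intro ψ i j hij
    rw [← ContinuousLinearMap.adjoint_inner_right, ← ContinuousLinearMap.star_eq_adjoint]
    have := congrArg (fun A : 𝓗 →L[ℂ] 𝓗 => A ψ) (ho i j hij)
    change (star (b i)) ((b j) ψ) = 0 at this
    rw [this, inner_zero_right]
  have hsum : ∀ ψ, Summable fun i => b i ψ := fun ψ =>
    (orth_norm_sum (hor ψ)).2 (Summable.of_nonneg_of_le (fun _ => by positivity) (hle ψ)
      ((PF.sq_sum hP ψ).summable.mul_left _))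
  let S0 : 𝓗 →ₗ[ℂ] 𝓗 :=
    { toFun := fun ψ => ∑' i, b i ψ
      map_add' := fun x y => by
        simp only [map_add]
        exact (hsum x).tsum_add (hsum y)
      map_smul' := fun a x => by
        simp only [map_smul, RingHom.id_apply]
        exact (hsum x).tsum_const_smul a }
  have hbound : ∀ ψ, ‖S0 ψ‖ ≤ c * ‖ψ‖ := by
    intro ψ
    have ht : Filter.Tendsto (fun s : Finset ℕ+ => ‖∑ i ∈ s, b i ψ‖) Filter.atTop
        (nhds ‖S0 ψ‖) := ((hsum ψ).hasSum).norm
    refine le_of_tendsto ht (Filter.Eventually.of_forall fun s => ?_)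
    refine (sq_le_sq₀ (norm_nonneg _) (by positivity)).1 ?_
    rw [(orth_norm_sum (hor ψ)).1 s, mul_pow]
    calc ∑ i ∈ s, ‖b i ψ‖ ^ 2 ≤ ∑ i ∈ s, c ^ 2 * ‖P i ψ‖ ^ 2 :=
          Finset.sum_le_sum fun i _ => hle ψ i
      _ = c ^ 2 * ∑ i ∈ s, ‖P i ψ‖ ^ 2 := by rw [Finset.mul_sum]
      _ ≤ c ^ 2 * ‖ψ‖ ^ 2 := by
          gcongr
          exact sum_le_hasSum s (fun _ _ => by positivity) (PF.sq_sum hP ψ)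
  refine ⟨S0.mkContinuous c hbound, LinearMap.mkContinuous_norm_le _ hc _, fun ψ => ?_⟩
  exact (hsum ψ).hasSum

lemma exists_op_band (hP : ProjFamily P) (a : ℕ+ → ℕ+ → 𝓗 →L[ℂ] 𝓗)
    (haP : ∀ m n, P m * a m n * P n = a m n) (c : ℝ) (hc : 0 ≤ c) (d : ℤ)
    (ha : ∀ m n : ℕ+, ((m : ℕ) : ℤ) - ((n : ℕ) : ℤ) = d → ‖a m n‖ ≤ c) :
    ∃ S : 𝓗 →L[ℂ] 𝓗, ‖S‖ ≤ c ∧ ∀ m n : ℕ+, P m * S * P n =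
      if ((m : ℕ) : ℤ) - ((n : ℕ) : ℤ) = d then a m n else 0 := by
  classical
  have hl : ∀ m n, P m * a m n = a m n := fun m n => by
    rw [← haP m n, mul_assoc, ← mul_assoc (P m) (P m), PF.idem hP]
  have hr : ∀ m n, a m n * P n = a m n := fun m n => by
    rw [← haP m n, mul_assoc, PF.idem hP]
  let b : ℕ+ → 𝓗 →L[ℂ] 𝓗 := fun n =>
    if h : ∃ m : ℕ+, ((m : ℕ) : ℤ) - ((n : ℕ) : ℤ) = d then a h.choose n else 0
  have hbval : ∀ m n : ℕ+, ((m : ℕ) : ℤ) - ((n : ℕ) : ℤ) = d → b n = a m n := by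
    intro m n h
    have hex : ∃ m : ℕ+, ((m : ℕ) : ℤ) - ((n : ℕ) : ℤ) = d := ⟨m, h⟩
    have hch := hex.choose_spec
    have : hex.choose = m := by
      apply PNat.coe_injective
      omega
    simp only [b, dif_pos hex, this]
  have hb0 : ∀ n : ℕ+, (¬ ∃ m : ℕ+, ((m : ℕ) : ℤ) - ((n : ℕ) : ℤ) = d) → b n = 0 := by
    intro n h
    simp only [b, dif_neg h]
  obtain ⟨S, hS, hsum⟩ := exists_orth_sum hP b c hc (by
    intro i j hij
    by_cases hi : ∃ m : ℕ+, ((m : ℕ) : ℤ) - ((i : ℕ) : ℤ) = d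
    · by_cases hj : ∃ m : ℕ+, ((m : ℕ) : ℤ) - ((j : ℕ) : ℤ) = d
      · obtain ⟨m, hm⟩ := hi
        obtain ⟨m', hm'⟩ := hj
        have hne : m ≠ m' := by
          rintro rfl
          apply hij
          apply PNat.coe_injective
          omega
        rw [hbval m i hm, hbval m' j hm', ← hl m i, ← hl m' j, star_mul, PF.star hP, mul_assoc,
          ← mul_assoc (P m) (P m'), PF.orth hP hne, zero_mul, mul_zero]
      · rw [hb0 j hj, mul_zero]
    · rw [hb0 i hi, star_zero, zero_mul]) (by
    intro i
    by_cases hi : ∃ m : ℕ+, ((m : ℕ) : ℤ) - ((i : ℕ) : ℤ) = d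
    · obtain ⟨m, hm⟩ := hi
      rw [hbval m i hm, hr]
    · rw [hb0 i hi, zero_mul]) (by
    intro i
    by_cases hi : ∃ m : ℕ+, ((m : ℕ) : ℤ) - ((i : ℕ) : ℤ) = d
    · obtain ⟨m, hm⟩ := hi
      rw [hbval m i hm]
      exact ha m i hm
    · rw [hb0 i hi, norm_zero]
      exact hc)
  refine ⟨S, hS, fun m n => ?_⟩
  have hbP : ∀ i, b i * P i = b i := by
    intro i
    by_cases hi : ∃ m : ℕ+, ((m : ℕ) : ℤ) - ((i : ℕ) : ℤ) = d
    · obtain ⟨m, hm⟩ := hi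
      rw [hbval m i hm, hr]
    · rw [hb0 i hi, zero_mul]
  have hSn : S * P n = b n := by
    ext ψ
    have h1 := hsum (P n ψ)
    have h2 : HasSum (fun i => b i (P n ψ)) (b n ψ) := by
      have : (fun i => b i (P n ψ)) = fun i => if i = n then b n ψ else 0 := by
        ext i
        have e1 : b i (P n ψ) = (b i * P i * P n) ψ := by rw [hbP]; rfl
        split_ifs with h
        · subst h
          rw [e1, mul_assoc, PF.idem hP, hbP]
        · rw [e1, mul_assoc, PF.orth hP h, mul_zero]; rfl
      rw [this]
      exact hasSum_ite_eq n _
    exact h1.unique h2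
  rw [mul_assoc, hSn]
  split_ifs with h
  · rw [hbval m n h, hl]
  · by_cases hi : ∃ m : ℕ+, ((m : ℕ) : ℤ) - ((n : ℕ) : ℤ) = d
    · obtain ⟨m', hm'⟩ := hi
      have hne : m ≠ m' := by rintro rfl; exact h hm'
      rw [hbval m' n hm', ← hl m' n, ← mul_assoc, PF.orth hP hne, zero_mul]
    · rw [hb0 n hi, mul_zero]

/-- Construction of a bounded operator from its blocks. -/
lemma exists_op (hP : ProjFamily P) (a : ℕ+ → ℕ+ → 𝓗 →L[ℂ] 𝓗)
    (haP : ∀ m n, P m * a m n * P n = a m n) (c r : ℝ) (hc : 0 ≤ c) (hr : 1 < r)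
    (ha : ∀ m n : ℕ+, ‖a m n‖ ≤ c * jap (((m : ℕ) : ℝ) - ((n : ℕ) : ℝ)) ^ (-r)) :
    ∃ A : 𝓗 →L[ℂ] 𝓗, ‖A‖ ≤ c * Zsum r ∧ ∀ m n, P m * A * P n = a m n := by
  have hjp : ∀ d : ℤ, 0 ≤ jap (d : ℝ) ^ (-r) := fun d => (Real.rpow_pos_of_pos (jap_pos _) _).le
  have h := fun d : ℤ => exists_op_band hP a haP (c * jap (d : ℝ) ^ (-r))
    (mul_nonneg hc (hjp d)) d (by
      intro m n hd
      refine (ha m n).trans (le_of_eq ?_)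
      rw [← hd]
      push_cast
      rfl)
  choose S hS hSb using h
  have hsn : Summable fun d => ‖S d‖ :=
    Summable.of_nonneg_of_le (fun _ => norm_nonneg _) hS ((summable_jap r hr).mul_left c)
  have hs : Summable S := hsn.of_norm
  refine ⟨∑' d, S d, ?_, fun m n => ?_⟩
  · refine (norm_tsum_le_tsum_norm hsn).trans ?_
    refine (hsn.tsum_le_tsum hS ((summable_jap r hr).mul_left c)).trans ?_
    rw [tsum_mul_left]
    rfl
  · have h1 : HasSum (fun d => P m * S d * P n) (P m * (∑' d, S d) * P n) :=
      (hs.hasSum.mul_left (P m)).mul_right (P n)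
    refine h1.unique ?_
    simp only [hSb]
    have := hasSum_ite_eq (((m : ℕ) : ℤ) - ((n : ℕ) : ℤ)) (a m n)
    convert this using 3
    exact eq_comm (a := (((m : ℕ) : ℤ) - ((n : ℕ) : ℤ)))

/-! #### Class calculus -/

lemma Cls.mono {a α b β x y : ℝ} {A : 𝓗 →L[ℂ] 𝓗} (h : Cls P a α x A) (hx : 0 ≤ x) (hxy : x ≤ y)
    (h1 : β ≤ α) (h2 : b ≤ a + 2 * (α - β)) : Cls P b β y A := fun m n =>
  (h m n).trans (mul_le_mul hxy (wt_le a α b β h1 h2 m n) (wt_pos _ _ _ _).le (hx.trans hxy))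

lemma Cls.le {a α x y : ℝ} {A : 𝓗 →L[ℂ] 𝓗} (h : Cls P a α x A) (hxy : x ≤ y) :
    Cls P a α y A := fun m n =>
  (h m n).trans (mul_le_mul_of_nonneg_right hxy (wt_pos _ _ _ _).le)

lemma Cls.add {a α x y : ℝ} {A B : 𝓗 →L[ℂ] 𝓗} (hA : Cls P a α x A) (hB : Cls P a α y B) :
    Cls P a α (x + y) (A + B) := fun m n => by
  rw [mul_add, add_mul, add_mul]
  exact (norm_add_le _ _).trans (add_le_add (hA m n) (hB m n))

lemma Cls.neg {a α x : ℝ} {A : 𝓗 →L[ℂ] 𝓗} (hA : Cls P a α x A) : Cls P a α x (-A) := fun m n => by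
  rw [mul_neg, neg_mul, norm_neg]
  exact hA m n

lemma Cls.sub {a α x y : ℝ} {A B : 𝓗 →L[ℂ] 𝓗} (hA : Cls P a α x A) (hB : Cls P a α y B) :
    Cls P a α (x + y) (A - B) := by
  rw [sub_eq_add_neg]; exact hA.add hB.neg

lemma Cls.smul {a α x : ℝ} {A : 𝓗 →L[ℂ] 𝓗} (hA : Cls P a α x A) (z : ℂ) :
    Cls P a α (‖z‖ * x) (z • A) := fun m n => by
  rw [mul_smul_comm, smul_mul_assoc, norm_smul, mul_assoc ‖z‖]
  exact mul_le_mul_of_nonneg_left (hA m n) (norm_nonneg z)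

lemma Cls.zero {a α : ℝ} : Cls P a α 0 (0 : 𝓗 →L[ℂ] 𝓗) := fun m n => by simp

lemma Cls.star {a α x : ℝ} {A : 𝓗 →L[ℂ] 𝓗} (hP : ProjFamily P) (hA : Cls P a α x A) :
    Cls P a α x (star A) := fun m n => by
  have : P m * Star.star A * P n = Star.star (P n * A * P m) := by
    rw [star_mul, star_mul, PF.star hP, PF.star hP, mul_assoc]
  rw [this, norm_star, wt_symm]
  exact hA n m

lemma Cls.mul {A B : 𝓗 →L[ℂ] 𝓗} {x y : ℝ} (hP : ProjFamily P) {a α b β : ℝ} (c α' β' θ : ℝ)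
    (hA : Cls P a α x A) (hB : Cls P b β y B) (hx : 0 ≤ x)
    (hα' : 0 ≤ α') (hβ' : 0 ≤ β') (hθ : 0 ≤ θ)
    (h1 : α' + θ ≤ α) (h2 : β' + θ ≤ β) (ha : c + 2 * β' ≤ a) (hb : c + 2 * α' ≤ b)
    (hc : 1 < c) : Cls P c (α' + β' + θ) (Mc c α' β' * (x * y)) (A * B) := by
  have hy : 0 ≤ y := by
    have := hB 1 1
    have h3 := wt_pos b β 1 1
    by_contra hn
    have := (norm_nonneg _).trans this
    nlinarith
  intro m n
  obtain ⟨hs, hle⟩ := wt_conv a α b β c α' β' θ hα' hβ' hθ h1 h2 ha hb hc m n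
  have hw := wt_pos c (α' + β' + θ) m n
  have hM := Mc_pos c α' β' hc
  refine ContinuousLinearMap.opNorm_le_bound _ (by positivity) fun ψ => ?_
  have hsum : HasSum (fun k => (P m * A * P k) ((P k * B * P n) ψ))
      ((P m * (A * B) * P n) ψ) := by
    have := (PF.sum hP (B (P n ψ))).mapL (P m * A)
    convert! this using 1
    ext k
    change (P m) (A (P k (P k (B (P n ψ))))) = (P m) (A (P k (B (P n ψ))))
    rw [PF.apply_idem hP]
  have hb2 : ∀ k, ‖(P m * A * P k) ((P k * B * P n) ψ)‖ ≤
      (x * y * ‖ψ‖) * (wt a α m k * wt b β k n) := by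
    intro k
    have w1 := wt_pos a α m k
    have w2 := wt_pos b β k n
    calc ‖(P m * A * P k) ((P k * B * P n) ψ)‖ ≤ (x * wt a α m k) * ‖(P k * B * P n) ψ‖ :=
          ContinuousLinearMap.le_of_opNorm_le _ (hA m k) _
      _ ≤ (x * wt a α m k) * ((y * wt b β k n) * ‖ψ‖) := by
          gcongr
          exact ContinuousLinearMap.le_of_opNorm_le _ (hB k n) _
      _ = _ := by ring
  rw [← hsum.tsum_eq]
  refine (tsum_of_norm_bounded (hs.hasSum.mul_left (x * y * ‖ψ‖)) hb2).trans ?_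
  calc x * y * ‖ψ‖ * ∑' k, wt a α m k * wt b β k n ≤
      x * y * ‖ψ‖ * (Mc c α' β' * wt c (α' + β' + θ) m n) := by gcongr
    _ = _ := by ring

lemma Cls.lim {a α x : ℝ} {ι : Type*} {l : Filter ι} [l.NeBot] {F : ι → 𝓗 →L[ℂ] 𝓗}
    {A : 𝓗 →L[ℂ] 𝓗} (h : ∀ i, Cls P a α x (F i)) (hl : Filter.Tendsto F l (nhds A)) :
    Cls P a α x A := fun m n => by
  have : Filter.Tendsto (fun i => ‖P m * F i * P n‖) l (nhds ‖P m * A * P n‖) :=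
    ((hl.const_mul (P m)).mul_const (P n)).norm
  exact le_of_tendsto this (Filter.Eventually.of_forall fun i => h i m n)

lemma Cls.norm_le {a α x : ℝ} {A : 𝓗 →L[ℂ] 𝓗} (hP : ProjFamily P) (h : Cls P a α x A)
    (hx : 0 ≤ x) (ha : 1 < a) (hα : 0 ≤ α) : ‖A‖ ≤ x * Zsum a := by
  obtain ⟨B, hB, hBb⟩ := exists_op hP (fun m n => P m * A * P n) (fun m n => by
    simp only [mul_assoc]
    rw [PF.idem hP, ← mul_assoc (P m) (P m), PF.idem hP]) x a hx ha (fun m n =>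
      (h m n).trans (by
        gcongr
        exact wt_le_jap a α hα m n))
  have : A = B := PF.ext hP fun m n => (hBb m n).symm
  rw [this]
  exact hB

/-- Schur multipliers. -/
lemma exists_mult (hP : ProjFamily P) {a α x b β y : ℝ} {A : 𝓗 →L[ℂ] 𝓗} (z : ℕ+ → ℕ+ → ℂ)
    (h : Cls P a α x A) (hb : 1 < b) (hβ : 0 ≤ β) (hy : 0 ≤ y)
    (hz : ∀ m n, ‖z m n‖ * (x * wt a α m n) ≤ y * wt b β m n) :
    ∃ B : 𝓗 →L[ℂ] 𝓗, (∀ m n, P m * B * P n = z m n • (P m * A * P n)) ∧ Cls P b β y B := by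
  have hcls : ∀ m n, ‖z m n • (P m * A * P n)‖ ≤ y * wt b β m n := fun m n => by
    rw [norm_smul]
    exact (mul_le_mul_of_nonneg_left (h m n) (norm_nonneg _)).trans (hz m n)
  obtain ⟨B, hB, hBb⟩ := exists_op hP (fun m n => z m n • (P m * A * P n)) (fun m n => by
    rw [mul_smul_comm, smul_mul_assoc]
    congr 1
    simp only [mul_assoc]
    rw [PF.idem hP, ← mul_assoc (P m) (P m), PF.idem hP]) y b hy hb (fun m n =>
      (hcls m n).trans (by
        gcongr
        exact wt_le_jap b β hβ m n))
  refine ⟨B, hBb, fun m n => ?_⟩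
  rw [hBb]
  exact hcls m n

end ops

set_option linter.unusedSectionVars false
set_option linter.unusedVariables false

/-! ### Bounded reformulation of commutators with `H` through `L = H⁻¹` -/

section comm
variable {P : ℕ+ → 𝓗 →L[ℂ] 𝓗}

/-- `L` is the inverse of `H`. -/
def IsInvH (P : ℕ+ → 𝓗 →L[ℂ] 𝓗) (E : ℕ+ → ℝ) (L : 𝓗 →L[ℂ] 𝓗) : Prop :=
  (∀ n, 0 < E n) ∧ (∀ n, P n * L = ((E n : ℂ))⁻¹ • P n) ∧ (∀ n, L * P n = ((E n : ℂ))⁻¹ • P n)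

/-- `C = [H, A]`. -/
def BC (L A C : 𝓗 →L[ℂ] 𝓗) : Prop := A * L - L * A = L * C * L

lemma exists_invH (hP : ProjFamily P) (E : ℕ+ → ℝ) (hE1 : 0 < E 1) (hE : StrictMono E) :
    ∃ L, IsInvH P E L := by
  have hle : ∀ n, E 1 ≤ E n := fun n => hE.monotone n.2
  have hpos : ∀ n, 0 < E n := fun n => hE1.trans_le (hle n)
  obtain ⟨L, hL, hs⟩ := exists_orth_sum hP (fun n => ((E n : ℂ))⁻¹ • P n) (E 1)⁻¹ (by positivity)
    (fun i j hij => by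
      rw [star_smul, PF.star hP, smul_mul_smul_comm, PF.orth hP hij, smul_zero])
    (fun i => by rw [smul_mul_assoc, PF.idem hP])
    (fun i => by
      rw [norm_smul, norm_inv, Complex.norm_real, Real.norm_of_nonneg (hpos i).le]
      calc (E i)⁻¹ * ‖P i‖ ≤ (E i)⁻¹ * 1 := by
            gcongr
            · exact (inv_pos.2 (hpos i)).le
            · exact PF.norm_le hP i
        _ ≤ (E 1)⁻¹ := by rw [mul_one]; exact inv_anti₀ hE1 (hle i))
  have hPP : ∀ i j ψ, P i (P j ψ) = if i = j then P i ψ else 0 := by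
    intro i j ψ
    split_ifs with h
    · subst h; exact PF.apply_idem hP i ψ
    · exact congrArg (fun A : 𝓗 →L[ℂ] 𝓗 => A ψ) (PF.orth hP h)
  refine ⟨L, hpos, fun n => ?_, fun n => ?_⟩
  · ext ψ
    have h1 := (hs ψ).mapL (P n)
    refine h1.unique ?_
    change HasSum _ ((E n : ℂ)⁻¹ • P n ψ)
    have := hasSum_ite_eq n (((E n : ℂ))⁻¹ • P n ψ)
    convert! this using 2 with i
    simp only [ContinuousLinearMap.smul_apply, map_smul, hPP]
    by_cases h : i = n
    · subst h; simp
    · rw [if_neg h, if_neg (Ne.symm h), smul_zero]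
  · ext ψ
    have h1 := hs (P n ψ)
    refine h1.unique ?_
    change HasSum _ ((E n : ℂ)⁻¹ • P n ψ)
    have := hasSum_ite_eq n (((E n : ℂ))⁻¹ • P n ψ)
    convert! this using 2 with i
    simp only [ContinuousLinearMap.smul_apply, hPP]
    by_cases h : i = n
    · subst h; simp
    · rw [if_neg h, if_neg h, smul_zero]

variable {E : ℕ+ → ℝ} {L : 𝓗 →L[ℂ] 𝓗}

lemma IsInvH.ne (hL : IsInvH P E L) (n : ℕ+) : (E n : ℂ) ≠ 0 :=
  Complex.ofReal_ne_zero.2 (hL.1 n).ne'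

lemma IsInvH.blk (hL : IsInvH P E L) (C : 𝓗 →L[ℂ] 𝓗) (m n : ℕ+) :
    P m * (L * C * L) * P n = ((E m : ℂ)⁻¹ * (E n : ℂ)⁻¹) • (P m * C * P n) := by
  calc P m * (L * C * L) * P n = (P m * L) * C * (L * P n) := by noncomm_ring
    _ = _ := by rw [hL.2.1, hL.2.2, smul_mul_assoc, smul_mul_smul_comm]

lemma IsInvH.star (hP : ProjFamily P) (hL : IsInvH P E L) : star L = L := by
  refine PF.ext hP fun m n => ?_
  have : P m * Star.star L * P n = Star.star (P n * L * P m) := by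
    rw [star_mul, star_mul, PF.star hP, PF.star hP, mul_assoc]
  rw [this, hL.2.1, hL.2.1, smul_mul_assoc, star_smul, star_mul, PF.star hP, PF.star hP,
    smul_mul_assoc]
  by_cases h : m = n
  · subst h; simp
  · rw [PF.orth hP h, smul_zero, smul_zero]

lemma IsInvH.apply (hL : IsInvH P E L) (n : ℕ+) (x : 𝓗) :
    P n (L x) = (E n : ℂ)⁻¹ • P n x :=
  congrArg (fun A : 𝓗 →L[ℂ] 𝓗 => A x) (hL.2.1 n)

lemma IsInvH.inj (hP : ProjFamily P) (hL : IsInvH P E L) {x y : 𝓗} (h : L x = L y) : x = y := by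
  refine PF.ext_left hP fun m => ?_
  have h1 := congrArg (P m) h
  rw [hL.apply, hL.apply] at h1
  exact smul_right_injective _ (inv_ne_zero (hL.ne m)) h1

lemma IsInvH.of_hsum (hP : ProjFamily P) (hL : IsInvH P E L) {ψ h : 𝓗} (hs : IsHSum P E ψ h) :
    L h = ψ := by
  refine PF.ext_left hP fun m => ?_
  rw [hL.apply]
  have h1 : P m h = (E m : ℂ) • P m ψ := by
    have h2 := hs.mapL (P m)
    refine h2.unique ?_
    have := hasSum_ite_eq m ((E m : ℂ) • P m ψ)
    convert! this using 2 with i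
    rw [map_smul]
    by_cases h : i = m
    · subst h; rw [if_pos rfl, PF.apply_idem hP]
    · rw [if_neg h]
      have := congrArg (fun A : 𝓗 →L[ℂ] 𝓗 => A ψ) (PF.orth hP (Ne.symm h))
      change P m (P i ψ) = 0 at this
      rw [this, smul_zero]
  rw [h1, smul_smul, inv_mul_cancel₀ (hL.ne m), one_smul]

lemma IsInvH.dom (hP : ProjFamily P) (hL : IsInvH P E L) (ψ : 𝓗) :
    ψ ∈ HDom P E ↔ ∃ φ, L φ = ψ := by
  constructor
  · intro h
    have hs : Summable fun n => (E n : ℂ) • P n ψ := by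
      refine (orth_norm_sum ?_).2 ?_
      · intro i j hij
        rw [inner_smul_left, inner_smul_right, PF.inner hP]
        have := congrArg (fun A : 𝓗 →L[ℂ] 𝓗 => A ψ) (PF.orth hP hij)
        change P i (P j ψ) = 0 at this
        rw [this]
        simp
      · refine Summable.congr h fun n => ?_
        rw [norm_smul, mul_pow, Complex.norm_real, Real.norm_eq_abs, sq_abs]
    exact ⟨_, hL.of_hsum hP hs.hasSum⟩
  · rintro ⟨φ, rfl⟩
    refine Summable.congr (PF.sq_sum hP φ).summable fun n => ?_
    rw [hL.apply, norm_smul, norm_inv, Complex.norm_real, Real.norm_eq_abs, mul_pow, inv_pow,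
      sq_abs]
    have := (hL.1 n).ne'
    field_simp

lemma BC.of_blocks (hP : ProjFamily P) (hL : IsInvH P E L) {A C : 𝓗 →L[ℂ] 𝓗}
    (h : ∀ m n, P m * C * P n = ((E m : ℂ) - (E n : ℂ)) • (P m * A * P n)) : BC L A C := by
  refine PF.ext hP fun m n => ?_
  rw [hL.blk, h, smul_smul]
  have : P m * (A * L - L * A) * P n = P m * A * (L * P n) - (P m * L) * A * P n := by noncomm_ring
  rw [this, hL.2.1, hL.2.2, mul_smul_comm, smul_mul_assoc, smul_mul_assoc, ← sub_smul]
  congr 1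
  have h1 := hL.ne m
  have h2 := hL.ne n
  field_simp

lemma BC.unique (hP : ProjFamily P) (hL : IsInvH P E L) {A C C' : 𝓗 →L[ℂ] 𝓗}
    (h : BC L A C) (h' : BC L A C') : C = C' := by
  refine PF.ext hP fun m n => ?_
  have e : L * C * L = L * C' * L := h.symm.trans h'
  have := congrArg (fun X => P m * X * P n) e
  simp only [hL.blk] at this
  exact smul_right_injective _
    (mul_ne_zero (inv_ne_zero (hL.ne m)) (inv_ne_zero (hL.ne n))) this

lemma BC.one : BC L 1 0 := by simp [BC]

lemma BC.mul {A C A' C' : 𝓗 →L[ℂ] 𝓗} (h : BC L A C) (h' : BC L A' C') :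
    BC L (A * A') (C * A' + A * C') := by
  unfold BC at *
  have e : A * A' * L - L * (A * A') = A * (A' * L - L * A') + (A * L - L * A) * A' := by
    noncomm_ring
  have e1 : A * (L * C' * L) = (A * L - L * A) * C' * L + L * A * C' * L := by noncomm_ring
  have e2 : (L * C * L) * A' = L * C * (A' * L) - L * C * (A' * L - L * A') := by noncomm_ring
  rw [e, h', h, e1, e2, h, h']
  noncomm_ring

lemma BC.smul {A C : 𝓗 →L[ℂ] 𝓗} (h : BC L A C) (z : ℂ) : BC L (z • A) (z • C) := by
  unfold BC at *
  rw [smul_mul_assoc, mul_smul_comm, ← smul_sub, h, mul_smul_comm, smul_mul_assoc]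

lemma BC.add {A C A' C' : 𝓗 →L[ℂ] 𝓗} (h : BC L A C) (h' : BC L A' C') :
    BC L (A + A') (C + C') := by
  unfold BC at *
  have e : (A + A') * L - L * (A + A') = (A * L - L * A) + (A' * L - L * A') := by noncomm_ring
  rw [e, h, h']
  noncomm_ring

lemma BC.star (hP : ProjFamily P) (hL : IsInvH P E L) {A C : 𝓗 →L[ℂ] 𝓗} (h : BC L A C) :
    BC L (star A) (-star C) := by
  unfold BC at *
  have := congrArg Star.star h
  simp only [star_sub, star_mul, hL.star hP] at this
  rw [← neg_sub, this]
  noncomm_ring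

lemma BC.inv {Q C R D : 𝓗 →L[ℂ] 𝓗} (h : BC L Q C) (h1 : R * Q = 1)
    (hD : (Q + C * L) * D = 1) : BC L R (-(R * C * R)) := by
  unfold BC at *
  have e1 : Q * L = L * (Q + C * L) := by
    have : Q * L = (Q * L - L * Q) + L * Q := by noncomm_ring
    rw [this, h]; noncomm_ring
  have e2 : R * L = L * D := by
    calc R * L = R * L * ((Q + C * L) * D) := by rw [hD, mul_one]
      _ = R * (L * (Q + C * L)) * D := by noncomm_ring
      _ = R * (Q * L) * D := by rw [e1]
      _ = (R * Q) * L * D := by noncomm_ring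
      _ = L * D := by rw [h1, one_mul]
  have e3 : D = R - R * C * (R * L) := by
    have : R * ((Q + C * L) * D) = R * 1 := by rw [hD]
    rw [e2]
    calc D = (R * Q) * D := by rw [h1, one_mul]
      _ = R * ((Q + C * L) * D) - R * C * (L * D) := by noncomm_ring
      _ = _ := by rw [this, mul_one]
  calc R * L - L * R = L * D - L * R := by rw [e2]
    _ = L * (R - R * C * (R * L)) - L * R := by rw [← e3]
    _ = _ := by noncomm_ring

lemma dom_image (hP : ProjFamily P) (hL : IsInvH P E L) {J C C' : 𝓗 →L[ℂ] 𝓗}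
    (h : BC L (star J) C) (h' : BC L J C') (hJ : star J * J = 1) :
    ⇑(star J) '' HDom P E = HDom P E := by
  have key : ∀ {A D : 𝓗 →L[ℂ] 𝓗}, BC L A D → ∀ ψ ∈ HDom P E, A ψ ∈ HDom P E := by
    intro A D hA ψ hψ
    obtain ⟨φ, rfl⟩ := (hL.dom hP ψ).1 hψ
    refine (hL.dom hP _).2 ⟨A φ + D (L φ), ?_⟩
    have e : A * L = L * (A + D * L) := by
      unfold BC at hA
      have : A * L = (A * L - L * A) + L * A := by noncomm_ring
      rw [this, hA]; noncomm_ring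
    exact (congrArg (fun X : 𝓗 →L[ℂ] 𝓗 => X φ) e).symm
  apply Set.Subset.antisymm
  · rintro _ ⟨ψ, hψ, rfl⟩
    exact key h ψ hψ
  · intro ψ hψ
    exact ⟨J ψ, key h' ψ hψ, congrArg (fun X : 𝓗 →L[ℂ] 𝓗 => X ψ) hJ⟩

lemma final_eq (hP : ProjFamily P) (hL : IsInvH P E L) {J C G V Jd : 𝓗 →L[ℂ] 𝓗}
    (h : BC L (star J) C) (hJ : J * star J = 1)
    (hV : V = J * C + J * G * star J + Complex.I • (Jd * star J)) (ψ h₁ h₂ : 𝓗)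
    (H1 : IsHSum P E ψ h₁) (H2 : IsHSum P E (star J ψ) h₂) :
    h₁ + V ψ = J (h₂ + G (star J ψ)) + Complex.I • Jd (star J ψ) := by
  have l1 := hL.of_hsum hP H1
  have l2 := hL.of_hsum hP H2
  have e : star J * L = L * (star J + C * L) := by
    unfold BC at h
    have : star J * L = (star J * L - L * star J) + L * star J := by noncomm_ring
    rw [this, h]; noncomm_ring
  have e2 : h₂ = star J h₁ + C ψ := by
    apply hL.inj hP
    rw [l2, ← l1]
    exact congrArg (fun X : 𝓗 →L[ℂ] 𝓗 => X h₁) e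
  have e3 : J (star J h₁) = h₁ := congrArg (fun X : 𝓗 →L[ℂ] 𝓗 => X h₁) hJ
  rw [e2, hV, map_add, map_add, e3]
  simp only [ContinuousLinearMap.add_apply, ContinuousLinearMap.smul_apply,
    ContinuousLinearMap.mul_apply']
  abel

/-! #### Cayley transform -/

/-- Algebra of the Cayley transform. -/
lemma cayley_alg {u v R S : 𝓗 →L[ℂ] 𝓗} (huv : u + v = 2) (hRu : R * u = 1) (huR : u * R = 1)
    (hSv : S * v = 1) (hvS : v * S = 1) :
    (2 * R - 1) * (2 * S - 1) = 1 ∧ (2 * S - 1) * (2 * R - 1) = 1 ∧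
    (2 * R - 1) * S = R ∧ R * (2 * S - 1) = S := by
  have h1 : 2 * R - 1 = R * v := by
    have : R * (u + v) = R * 2 := by rw [huv]
    rw [mul_add, hRu] at this
    have e : 2 * R = R * 2 := by noncomm_ring
    rw [e, ← this]; abel
  have h1' : 2 * R - 1 = v * R := by
    have : (u + v) * R = 2 * R := by rw [huv]
    rw [add_mul, huR] at this
    rw [← this]; abel
  have h2 : 2 * S - 1 = u * S := by
    have : (u + v) * S = 2 * S := by rw [huv]
    rw [add_mul, hvS] at this
    rw [← this]; abel
  refine ⟨?_, ?_, ?_, ?_⟩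
  · rw [h1, h2, mul_assoc, ← mul_assoc v]
    have : v * u = u * v := by
      have e : v = 2 - u := by rw [← huv]; abel
      rw [e]; noncomm_ring
    rw [this, mul_assoc, hvS, mul_one, hRu]
  · rw [h1', h2, mul_assoc, ← mul_assoc S, hSv, one_mul, huR]
  · rw [h1, mul_assoc, hvS, mul_one]
  · rw [h2, ← mul_assoc, hRu, one_mul]

/-- The Cayley transform step. `N = [H,K]`, `Kd = K̇`. -/
lemma cayley_step (hP : ProjFamily P) (hL : IsInvH P E L) {K N R D Kd G : 𝓗 →L[ℂ] 𝓗}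
    (hK : star K = K) (hN : BC L K N)
    (hR1 : R * (1 - Complex.I • K) = 1) (hR2 : (1 - Complex.I • K) * R = 1)
    (hD : (1 - Complex.I • K + (-(Complex.I • N)) * L) * D = 1) :
    star N = -N ∧
    ((2 * R - 1) * star (2 * R - 1) = 1 ∧ star (2 * R - 1) * (2 * R - 1) = 1) ∧
    (∃ C', BC L (2 * R - 1) C') ∧
    ∃ C, BC L (star (2 * R - 1)) C ∧
      G = (2 * R - 1) * C + (2 * R - 1) * (star R * ((2 * Complex.I) • N +
        (1 - Complex.I • K) * G * (1 + Complex.I • K) + 2 * Kd) * R) * star (2 * R - 1) +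
        Complex.I • ((2 * (R * (Complex.I • Kd) * R)) * star (2 * R - 1)) := by
  set u := 1 - Complex.I • K with hu
  set v := 1 + Complex.I • K with hv
  have hsu : star u = v := by
    rw [hu, hv, star_sub, star_one, star_smul, hK, Complex.star_def, Complex.conj_I, neg_smul,
      sub_neg_eq_add]
  have hSv : star R * v = 1 := by
    rw [← hsu, ← star_mul, hR2, star_one]
  have hvS : v * star R = 1 := by
    rw [← hsu, ← star_mul, hR1, star_one]
  have huv : u + v = 2 := by
    rw [hu, hv, sub_add_add_cancel]
    norm_num
  obtain ⟨a1, a2, a3, a4⟩ := cayley_alg huv hR1 hR2 hSv hvS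
  have hsJ : star (2 * R - 1) = 2 * star R - 1 := by
    have e : (2 : 𝓗 →L[ℂ] 𝓗) * R - 1 = R + R - 1 := by noncomm_ring
    rw [e, star_sub, star_add, star_one]; noncomm_ring
  have hNs : star N = -N := by
    have h := hN.star hP hL
    rw [hK] at h
    have := BC.unique hP hL h hN
    exact neg_eq_iff_eq_neg.1 this
  have hQ : BC L u (-(Complex.I • N)) := by
    have h := (BC.one (L := L)).add (hN.smul (-Complex.I))
    convert h using 1
    · rw [hu, neg_smul, sub_eq_add_neg]
    · rw [neg_smul, zero_add]
  have hRC := hQ.inv hR1 hD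
  have hJC : ∀ {X Y : 𝓗 →L[ℂ] 𝓗}, BC L X Y → BC L (2 * X - 1) (2 * Y) := by
    intro X Y h
    have h := (h.add h).add ((BC.one (L := L)).smul (-1))
    convert h using 1
    · rw [neg_one_smul]; noncomm_ring
    · rw [smul_zero, add_zero]; noncomm_ring
  have hSC := hRC.star hP hL
  refine ⟨hNs, ⟨by rw [hsJ]; exact a1, by rw [hsJ]; exact a2⟩, ⟨_, hJC hRC⟩, ?_⟩
  rw [hsJ]
  refine ⟨_, hJC hSC, ?_⟩
  have hCs : -star (-(R * -(Complex.I • N) * R)) = -(Complex.I • (star R * N * star R)) := by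
    simp only [star_neg, star_mul, star_smul, hNs, Complex.star_def, Complex.conj_I, mul_neg,
      neg_mul, smul_mul_assoc, mul_smul_comm, neg_smul, smul_neg, neg_neg, mul_assoc]
  rw [hCs]
  have t1 : (2 * R - 1) * (2 * -(Complex.I • (star R * N * star R))) =
      -((2 * Complex.I) • (R * N * star R)) := by
    have e : (2 * R - 1) * (2 * -(Complex.I • (star R * N * star R))) =
      -(2 * (Complex.I • ((2 * R - 1) * star R * N * star R))) := by
      simp only [mul_neg, mul_smul_comm]
      noncomm_ring
    rw [e, a3, mul_smul, two_mul, two_smul]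
  have t2 : (2 * R - 1) * (star R * ((2 * Complex.I) • N + u * G * v + 2 * Kd) * R) *
      (2 * star R - 1) = (2 * Complex.I) • (R * N * star R) + G + 2 * (R * Kd * star R) := by
    calc _ = ((2 * R - 1) * star R) * ((2 * Complex.I) • N + u * G * v + 2 * Kd) *
          (R * (2 * star R - 1)) := by noncomm_ring
      _ = R * ((2 * Complex.I) • N + u * G * v + 2 * Kd) * star R := by rw [a3, a4]
      _ = R * ((2 * Complex.I) • N) * star R + (R * u) * G * (v * star R) +
          2 * (R * Kd * star R) := by noncomm_ring
      _ = _ := by rw [hR1, hvS, one_mul, mul_one, mul_smul_comm, smul_mul_assoc]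
  have t3 : Complex.I • (2 * (R * (Complex.I • Kd) * R) * (2 * star R - 1)) =
      -(2 * (R * Kd * star R)) := by
    calc _ = Complex.I • (2 * (R * (Complex.I • Kd) * (R * (2 * star R - 1)))) := by
          congr 1
      _ = _ := by
          rw [a4, mul_smul_comm, smul_mul_assoc, mul_smul_comm, smul_smul, Complex.I_mul_I,
            neg_one_smul]
  rw [t1, t2, t3]
  abel

end comm

set_option linter.unusedSectionVars false
set_option linter.unusedVariables false

/-! ### Strongly `C¹` families -/

section strong

lemma banach_local {ι : Type*} (F : ι → 𝓗 →L[ℂ] 𝓗) (h : ∀ x, ∃ C, ∀ i, ‖F i x‖ ≤ C) :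
    ∃ C, ∀ i, ‖F i‖ ≤ C := banach_steinhaus h

lemma StrongC1.lip {B : ℝ → 𝓗 →L[ℂ] 𝓗} (hB : StrongC1 B) (t : ℝ) :
    ∃ C : ℝ, ∀ s, |s - t| ≤ 1 → ‖B s - B t‖ ≤ C * |s - t| := by
  let F : {s : ℝ // |s - t| ≤ 1} → 𝓗 →L[ℂ] 𝓗 := fun s => ((s.1 - t : ℝ) : ℂ)⁻¹ • (B s.1 - B t)
  obtain ⟨C, hC⟩ := banach_local F (by
    intro x
    have hd := hB x
    have hdc : Continuous (deriv fun t => B t x) := hd.continuous_deriv le_rfl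
    obtain ⟨C, hC⟩ := (isCompact_Icc (a := t - 1) (b := t + 1)).exists_bound_of_continuousOn
      hdc.continuousOn
    refine ⟨C, fun s => ?_⟩
    have hs := abs_le.1 s.2
    have hC0 : 0 ≤ C := (norm_nonneg _).trans (hC t ⟨by linarith, by linarith⟩)
    have := (convex_Icc (t - 1) (t + 1)).norm_image_sub_le_of_norm_deriv_le
      (f := fun t => B t x) (fun y _ => (hd.differentiable one_ne_zero) y) hC
      (x := t) (y := s.1) ⟨by linarith, by linarith⟩ ⟨by linarith, by linarith⟩
    simp only [F, smul_apply, sub_apply, norm_smul, norm_inv, Complex.norm_real]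
    by_cases h0 : s.1 - t = 0
    · simp [h0, hC0]
    · have : 0 < ‖s.1 - t‖ := norm_pos_iff.2 h0
      rw [inv_mul_le_iff₀ this]
      linarith)
  refine ⟨C, fun s hs => ?_⟩
  have := hC ⟨s, hs⟩
  simp only [F, norm_smul, norm_inv, Complex.norm_real] at this
  by_cases h0 : s - t = 0
  · have : s = t := by linarith
    subst this; simp
  · have hp : 0 < ‖s - t‖ := norm_pos_iff.2 h0
    rw [inv_mul_le_iff₀ hp] at this
    rw [Real.norm_eq_abs] at this
    linarith

lemma StrongC1.continuous {B : ℝ → 𝓗 →L[ℂ] 𝓗} (hB : StrongC1 B) : Continuous B := by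
  rw [continuous_iff_continuousAt]
  intro t
  obtain ⟨C, hC⟩ := hB.lip t
  rw [ContinuousAt, tendsto_iff_norm_sub_tendsto_zero]
  refine squeeze_zero' (Filter.Eventually.of_forall fun _ => norm_nonneg _)
    (g := fun s => C * |s - t|) ?_ ?_
  · filter_upwards [Metric.closedBall_mem_nhds t one_pos] with s hs
    exact hC s (by rwa [Metric.mem_closedBall, Real.dist_eq] at hs)
  · have : Continuous fun s => C * |s - t| := by fun_prop
    have h := this.tendsto t
    simpa using h

lemma StrongC1.exists_deriv {B : ℝ → 𝓗 →L[ℂ] 𝓗} (hB : StrongC1 B) :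
    ∃ D : ℝ → 𝓗 →L[ℂ] 𝓗, (∀ ψ t, HasDerivAt (fun s => B s ψ) (D t ψ) t) ∧
      ∀ ψ, Continuous fun t => D t ψ := by
  have key : ∀ t, ∃ D : 𝓗 →L[ℂ] 𝓗, ∀ ψ, D ψ = deriv (fun s => B s ψ) t := by
    intro t
    obtain ⟨C, hC⟩ := hB.lip t
    have hlin : ∀ ψ, HasDerivAt (fun s => B s ψ) (deriv (fun s => B s ψ) t) t := fun ψ =>
      ((hB ψ).differentiable one_ne_zero t).hasDerivAt
    have hbd : ∀ ψ, ‖deriv (fun s => B s ψ) t‖ ≤ (C * 1 + 0) * ‖ψ‖ := by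
      intro ψ
      have h1 := (hasDerivAt_iff_tendsto_slope.1 (hlin ψ)).norm
      refine le_of_tendsto h1 ?_
      have hn : ∀ᶠ s in nhdsWithin t {t}ᶜ, s ∈ Metric.closedBall t 1 :=
        nhdsWithin_le_nhds (Metric.closedBall_mem_nhds t one_pos)
      filter_upwards [hn, self_mem_nhdsWithin] with s hs hne
      have hs' := hC s (by rwa [Metric.mem_closedBall, Real.dist_eq] at hs)
      have hp : 0 < |s - t| := abs_pos.2 (sub_ne_zero.2 hne)
      rw [slope_def_module, norm_smul, norm_inv, Real.norm_eq_abs, inv_mul_le_iff₀ hp]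
      calc ‖B s ψ - B t ψ‖ = ‖(B s - B t) ψ‖ := rfl
        _ ≤ ‖B s - B t‖ * ‖ψ‖ := le_opNorm _ _
        _ ≤ (C * |s - t|) * ‖ψ‖ := by gcongr
        _ = _ := by ring
    refine ⟨LinearMap.mkContinuous
      { toFun := fun ψ => deriv (fun s => B s ψ) t
        map_add' := fun x y => ?_
        map_smul' := fun z x => ?_ } _ hbd, fun ψ => rfl⟩
    · have := (hlin x).add (hlin y)
      refine HasDerivAt.deriv ?_
      convert! this using 1
      ext s; simp
    · have := (hlin x).const_smul z
      refine HasDerivAt.deriv ?_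
      convert! this using 1
      ext s; simp
  choose D hD using key
  refine ⟨D, fun ψ t => ?_, fun ψ => ?_⟩
  · rw [hD]; exact ((hB ψ).differentiable one_ne_zero t).hasDerivAt
  · simp only [hD]; exact (hB ψ).continuous_deriv le_rfl

lemma strong_cont_apply {F : ℝ → 𝓗 →L[ℂ] 𝓗} (hF : ∀ ψ, Continuous fun t => F t ψ) {f : ℝ → 𝓗}
    (hf : Continuous f) : Continuous fun t => F t (f t) := by
  rw [continuous_iff_continuousAt]
  intro t
  obtain ⟨C, hC⟩ := banach_local (fun s : Set.Icc (t - 1) (t + 1) => F s.1) (by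
    intro x
    obtain ⟨C, hC⟩ := (isCompact_Icc (a := t - 1) (b := t + 1)).exists_bound_of_continuousOn
      (hF x).continuousOn
    exact ⟨C, fun s => hC s.1 s.2⟩)
  rw [ContinuousAt, tendsto_iff_norm_sub_tendsto_zero]
  refine squeeze_zero' (Filter.Eventually.of_forall fun _ => norm_nonneg _)
    (g := fun s => C * ‖f s - f t‖ + ‖F s (f t) - F t (f t)‖) ?_ ?_
  · filter_upwards [Icc_mem_nhds (a := t - 1) (b := t + 1) (x := t) (by linarith) (by linarith)]
      with s hs
    calc ‖F s (f s) - F t (f t)‖ = ‖F s (f s - f t) + (F s (f t) - F t (f t))‖ := by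
          rw [map_sub]; congr 1; abel
      _ ≤ ‖F s (f s - f t)‖ + ‖F s (f t) - F t (f t)‖ := norm_add_le _ _
      _ ≤ _ := by
          gcongr
          exact (F s).le_of_opNorm_le (hC ⟨s, hs⟩) _
  · have : Continuous fun s => C * ‖f s - f t‖ + ‖F s (f t) - F t (f t)‖ := by
      have := hF (f t)
      fun_prop
    have h := this.tendsto t
    simpa using h

lemma tendsto_clm {ι : Type*} {l : Filter ι} {F : ι → 𝓗 →L[ℂ] 𝓗} {A : 𝓗 →L[ℂ] 𝓗} {f : ι → 𝓗}
    {x : 𝓗} (hF : Filter.Tendsto F l (nhds A)) (hf : Filter.Tendsto f l (nhds x)) :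
    Filter.Tendsto (fun i => F i (f i)) l (nhds (A x)) :=
  ((isBoundedBilinearMap_apply (𝕜 := ℂ) (E := 𝓗) (F := 𝓗)).continuous.tendsto (A, x)).comp
    (hF.prodMk_nhds hf)

lemma StrongC1.apply {A : ℝ → 𝓗 →L[ℂ] 𝓗} (hA : StrongC1 A) {f : ℝ → 𝓗} (hf : ContDiff ℝ 1 f) :
    ContDiff ℝ 1 fun t => A t (f t) := by
  obtain ⟨D, hD, hDc⟩ := hA.exists_deriv
  have hfd : ∀ t, HasDerivAt f (deriv f t) t := fun t =>
    (hf.differentiable one_ne_zero t).hasDerivAt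
  have hfc : Continuous (deriv f) := hf.continuous_deriv le_rfl
  have hder : ∀ t, HasDerivAt (fun t => A t (f t)) (D t (f t) + A t (deriv f t)) t := by
    intro t
    rw [hasDerivAt_iff_tendsto_slope]
    have h1 := hasDerivAt_iff_tendsto_slope.1 (hD (f t) t)
    have h2 := hasDerivAt_iff_tendsto_slope.1 (hfd t)
    have h3 : Filter.Tendsto A (nhdsWithin t {t}ᶜ) (nhds (A t)) :=
      (hA.continuous.tendsto t).mono_left nhdsWithin_le_nhds
    have h4 := tendsto_clm h3 h2
    refine (h1.add h4).congr fun s => ?_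
    simp only [slope_def_module]
    rw [← Complex.coe_smul, ← Complex.coe_smul, ← Complex.coe_smul, map_smul, ← smul_add, map_sub]
    congr 1
    abel
  rw [contDiff_one_iff_deriv]
  refine ⟨fun t => (hder t).differentiableAt, ?_⟩
  have : deriv (fun t => A t (f t)) = fun t => D t (f t) + A t (deriv f t) :=
    funext fun t => (hder t).deriv
  rw [this]
  exact (strong_cont_apply hDc hf.continuous).add (hA.continuous.clm_apply hfc)

lemma StrongC1.mul {A B : ℝ → 𝓗 →L[ℂ] 𝓗} (hA : StrongC1 A) (hB : StrongC1 B) :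
    StrongC1 fun t => A t * B t := fun ψ => hA.apply (hB ψ)

lemma StrongC1.add {A B : ℝ → 𝓗 →L[ℂ] 𝓗} (hA : StrongC1 A) (hB : StrongC1 B) :
    StrongC1 fun t => A t + B t := fun ψ => (hA ψ).add (hB ψ)

lemma StrongC1.sub {A B : ℝ → 𝓗 →L[ℂ] 𝓗} (hA : StrongC1 A) (hB : StrongC1 B) :
    StrongC1 fun t => A t - B t := fun ψ => (hA ψ).sub (hB ψ)

lemma StrongC1.smul {A : ℝ → 𝓗 →L[ℂ] 𝓗} (hA : StrongC1 A) (z : ℂ) :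
    StrongC1 fun t => z • A t := fun ψ => (hA ψ).const_smul z

lemma StrongC1.const (A : 𝓗 →L[ℂ] 𝓗) : StrongC1 fun _ => A := fun ψ => contDiff_const

lemma StrongC1.of_contDiff {A : ℝ → 𝓗 →L[ℂ] 𝓗} (hA : ContDiff ℝ 1 A) : StrongC1 A := by
  intro ψ
  have h : IsBoundedLinearMap ℝ (fun X : 𝓗 →L[ℂ] 𝓗 => X ψ) :=
    { map_add := fun x y => rfl
      map_smul := fun c x => rfl
      bound := ⟨‖ψ‖ + 1, by positivity, fun X => (X.le_opNorm ψ).trans (by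
        have := norm_nonneg X
        have := norm_nonneg ψ
        nlinarith)⟩ }
  exact h.contDiff.comp hA

lemma contDiff_star_op {A : ℝ → 𝓗 →L[ℂ] 𝓗} (hA : ContDiff ℝ 1 A) :
    ContDiff ℝ 1 fun t => star (A t) := by
  have h : IsBoundedLinearMap ℝ (fun X : 𝓗 →L[ℂ] 𝓗 => star X) :=
    { map_add := fun x y => star_add x y
      map_smul := fun c x => by
        rw [← Complex.coe_smul, ← Complex.coe_smul, star_smul, Complex.star_def,
          Complex.conj_ofReal]
      bound := ⟨1, by positivity, fun X => by rw [norm_star, one_mul]⟩ }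
  exact h.contDiff.comp hA

lemma contDiff_mul_op {A B : ℝ → 𝓗 →L[ℂ] 𝓗} (hA : ContDiff ℝ 1 A) (hB : ContDiff ℝ 1 B) :
    ContDiff ℝ 1 fun t => A t * B t := hA.mul hB

lemma hasDerivAt_apply_op {A : ℝ → 𝓗 →L[ℂ] 𝓗} {D : 𝓗 →L[ℂ] 𝓗} {t : ℝ} (h : HasDerivAt A D t)
    (ψ : 𝓗) : HasDerivAt (fun s => A s ψ) (D ψ) t := by
  rw [hasDerivAt_iff_tendsto_slope] at *
  have h2 := tendsto_clm h (tendsto_const_nhds (x := ψ))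
  refine h2.congr fun s => ?_
  simp only [slope_def_module]
  rfl

end strong

/-! ### Integrals -/

section integ
variable {P : ℕ+ → 𝓗 →L[ℂ] 𝓗}

lemma blk_integral {F : ℝ → 𝓗 →L[ℂ] 𝓗} (hF : Continuous F) (X Y : 𝓗 →L[ℂ] 𝓗) (a b : ℝ) :
    X * (∫ t in a..b, F t) * Y = ∫ t in a..b, X * F t * Y := by
  have := ((ContinuousLinearMap.mulLeftRight ℂ (𝓗 →L[ℂ] 𝓗) X Y)).intervalIntegral_comp_comm
    (hF.intervalIntegrable (μ := MeasureTheory.volume) a b)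
  simp only [ContinuousLinearMap.mulLeftRight_apply] at this
  exact this.symm

lemma Cls.integral {r δ x : ℝ} {F : ℝ → 𝓗 →L[ℂ] 𝓗} (hF : Continuous F)
    (h : ∀ t, Cls P r δ x (F t)) (a b : ℝ) : Cls P r δ (|b - a| * x) (∫ t in a..b, F t) := by
  intro m n
  rw [blk_integral hF]
  refine (intervalIntegral.norm_integral_le_of_norm_le_const fun t _ => h t m n).trans ?_
  exact le_of_eq (by ring)

lemma star_integral {F : ℝ → 𝓗 →L[ℂ] 𝓗} (hF : Continuous F) (h : ∀ t, star (F t) = F t)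
    (a b : ℝ) : star (∫ t in a..b, F t) = ∫ t in a..b, F t := by
  have := ((starL' ℝ : (𝓗 →L[ℂ] 𝓗) ≃L[ℝ] (𝓗 →L[ℂ] 𝓗)) :
    (𝓗 →L[ℂ] 𝓗) →L[ℝ] (𝓗 →L[ℂ] 𝓗)).intervalIntegral_comp_comm
    (hF.intervalIntegrable (μ := MeasureTheory.volume) a b)
  simp only [ContinuousLinearEquiv.coe_coe, starL'_apply, h] at this
  exact this.symm

lemma contDiff_integral {F : ℝ → 𝓗 →L[ℂ] 𝓗} (hF : Continuous F) :
    (∀ t, HasDerivAt (fun s => ∫ τ in (0 : ℝ)..s, F τ) (F t) t) ∧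
    ContDiff ℝ 1 (fun s => ∫ τ in (0 : ℝ)..s, F τ) := by
  have h : ∀ t, HasDerivAt (fun s => ∫ τ in (0 : ℝ)..s, F τ) (F t) t := fun t =>
    hF.integral_hasStrictDerivAt 0 t |>.hasDerivAt
  refine ⟨h, ?_⟩
  rw [contDiff_one_iff_deriv]
  refine ⟨fun t => (h t).differentiableAt, ?_⟩
  rw [funext fun t => (h t).deriv]
  exact hF

end integ

set_option linter.unusedSectionVars false
set_option linter.unusedVariables false

/-! ### Neumann series, Cayley families, reductions -/

section neu
variable {P : ℕ+ → 𝓗 →L[ℂ] 𝓗}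

lemma neumann_basic {X : 𝓗 →L[ℂ] 𝓗} (h : ‖X‖ < 1) :
    IsUnit (1 - X) ∧ Ring.inverse (1 - X) * (1 - X) = 1 ∧ (1 - X) * Ring.inverse (1 - X) = 1 := by
  have hu : IsUnit (1 - X) := (Units.oneSub X h).isUnit
  exact ⟨hu, Ring.inverse_mul_cancel _ hu, Ring.mul_inverse_cancel _ hu⟩

lemma neumann_cls (hP : ProjFamily P) {a α b : ℝ} {X : 𝓗 →L[ℂ] 𝓗} (hX : Cls P a α b X)
    (hb : 0 ≤ b) (ha : 1 < a) (hα : 0 ≤ α) (h1 : 2 * Mc a 0 0 * b ≤ 1) (hn : ‖X‖ < 1) :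
    Cls P a α (2 * b) (Ring.inverse (1 - X) - 1) := by
  obtain ⟨hu, hl, hr⟩ := neumann_basic hn
  set R := Ring.inverse (1 - X) with hR
  let Y : ℕ → 𝓗 →L[ℂ] 𝓗 := fun n => Nat.rec 0 (fun _ Z => X + X * Z) n
  have hY : ∀ n, Cls P a α (2 * b) (Y n) := by
    intro n
    induction n with
    | zero => exact (Cls.zero (P := P)).le (by positivity)
    | succ k ih =>
      have h := hX.mul hP a 0 0 α ih hb le_rfl le_rfl hα (by linarith) (by linarith)
        (by linarith) (by linarith) ha
      rw [zero_add, zero_add] at h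
      refine (hX.add h).le ?_
      nlinarith
  have hfix : R - 1 = X + X * (R - 1) := by
    have : R - X * R = 1 := by rw [← hr]; noncomm_ring
    calc R - 1 = (R - X * R) + X * R - 1 := by abel
      _ = X * R := by rw [this]; abel
      _ = _ := by noncomm_ring
  have hd : ∀ n, ‖Y n - (R - 1)‖ ≤ ‖X‖ ^ n * ‖R - 1‖ := by
    intro n
    induction n with
    | zero => simp [Y, norm_sub_rev]
    | succ k ih =>
      have e : Y (k + 1) - (R - 1) = X * (Y k - (R - 1)) := by
        have : Y (k + 1) = X + X * Y k := rfl
        rw [this, mul_sub]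
        nth_rewrite 1 [hfix]
        abel
      rw [e]
      calc _ ≤ ‖X‖ * ‖Y k - (R - 1)‖ := norm_mul_le _ _
        _ ≤ ‖X‖ * (‖X‖ ^ k * ‖R - 1‖) := by gcongr
        _ = _ := by ring
  refine Cls.lim hY (l := Filter.atTop) ?_
  rw [tendsto_iff_norm_sub_tendsto_zero]
  refine squeeze_zero (fun _ => norm_nonneg _) hd ?_
  have := (tendsto_pow_atTop_nhds_zero_of_lt_one (norm_nonneg X) hn).mul_const ‖R - 1‖
  rwa [zero_mul] at this

lemma resolvent_deriv {K : ℝ → 𝓗 →L[ℂ] 𝓗} (hK : ContDiff ℝ 1 K) (hu : ∀ t, IsUnit (1 - K t)) :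
    (∀ t, HasDerivAt (fun s => Ring.inverse (1 - K s))
      (Ring.inverse (1 - K t) * deriv K t * Ring.inverse (1 - K t)) t) ∧
    ContDiff ℝ 1 fun s => Ring.inverse (1 - K s) := by
  have h : ∀ t, HasDerivAt (fun s => Ring.inverse (1 - K s))
      (Ring.inverse (1 - K t) * deriv K t * Ring.inverse (1 - K t)) t := by
    intro t
    obtain ⟨u, hu'⟩ := hu t
    have h1 := hasFDerivAt_ringInverse (𝕜 := ℝ) u
    have h2 : HasDerivAt (fun s => 1 - K s) (-deriv K t) t :=
      ((hK.differentiable one_ne_zero t).hasDerivAt).const_sub 1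
    rw [hu'] at h1
    have h3 := h1.comp_hasDerivAt t h2
    convert! h3 using 1
    rw [← hu', Ring.inverse_unit]
    simp [ContinuousLinearMap.mulLeftRight_apply]
  refine ⟨h, ?_⟩
  rw [contDiff_one_iff_deriv]
  refine ⟨fun t => (h t).differentiableAt, ?_⟩
  rw [funext fun t => (h t).deriv]
  have hc : Continuous fun s => Ring.inverse (1 - K s) :=
    continuous_iff_continuousAt.2 fun t => (h t).continuousAt
  exact (hc.mul (hK.continuous_deriv le_rfl)).mul hc

/-- `J` conjugates `H + V(t)` to `H + G(t)`. -/
structure Red (L : 𝓗 →L[ℂ] 𝓗) (T : ℝ) (V J G : ℝ → 𝓗 →L[ℂ] 𝓗) : Prop where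
  unit : ∀ t, J t * star (J t) = 1 ∧ star (J t) * J t = 1
  per : ∀ t, J (t + T) = J t
  smooth : ContDiff ℝ 1 J
  bc : ∀ t, ∃ C', BC L (J t) C'
  eq : ∀ t, ∃ C, BC L (star (J t)) C ∧
    V t = J t * C + J t * G t * star (J t) + Complex.I • (deriv J t * star (J t))

lemma Red.refl (L : 𝓗 →L[ℂ] 𝓗) (T : ℝ) (V : ℝ → 𝓗 →L[ℂ] 𝓗) : Red L T V (fun _ => 1) V where
  unit t := by simp
  per t := rfl
  smooth := contDiff_const
  bc t := ⟨0, BC.one⟩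
  eq t := ⟨0, by rw [star_one]; exact BC.one, by simp⟩

lemma Red.comp {L : 𝓗 →L[ℂ] 𝓗} {T : ℝ} {V J G J' G' : ℝ → 𝓗 →L[ℂ] 𝓗} (h : Red L T V J G)
    (h' : Red L T G J' G') : Red L T V (fun t => J t * J' t) G' where
  unit t := by
    obtain ⟨a, b⟩ := h.unit t
    obtain ⟨a', b'⟩ := h'.unit t
    rw [star_mul]
    constructor
    · rw [mul_assoc, ← mul_assoc (J' t), a', one_mul, a]
    · rw [mul_assoc, ← mul_assoc (star (J t)), b, one_mul, b']
  per t := by simp only [h.per, h'.per]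
  smooth := h.smooth.mul h'.smooth
  bc t := by
    obtain ⟨C, hC⟩ := h.bc t
    obtain ⟨C', hC'⟩ := h'.bc t
    exact ⟨_, hC.mul hC'⟩
  eq t := by
    obtain ⟨C, hC, e⟩ := h.eq t
    obtain ⟨C', hC', e'⟩ := h'.eq t
    have a' := (h'.unit t).1
    have hd : deriv (fun t => J t * J' t) t = deriv J t * J' t + J t * deriv J' t :=
      ((h.smooth.differentiable one_ne_zero t).hasDerivAt.mul
        (h'.smooth.differentiable one_ne_zero t).hasDerivAt).deriv
    rw [hd, star_mul]
    refine ⟨_, hC'.mul hC, ?_⟩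
    have e1 : (J t * J' t) * (C' * star (J t) + star (J' t) * C) =
        J t * (J' t * C') * star (J t) + J t * C := by
      calc _ = J t * (J' t * C') * star (J t) + J t * (J' t * star (J' t)) * C := by noncomm_ring
        _ = _ := by rw [a', mul_one]
    have e2 : (deriv J t * J' t + J t * deriv J' t) * (star (J' t) * star (J t)) =
        deriv J t * star (J t) + J t * (deriv J' t * star (J' t)) * star (J t) := by
      calc _ = deriv J t * (J' t * star (J' t)) * star (J t) +
            J t * (deriv J' t * star (J' t)) * star (J t) := by noncomm_ring
        _ = _ := by rw [a', mul_one]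
    rw [e1, e2, e]
    conv_lhs => rw [e']
    simp only [mul_add, add_mul, smul_add, mul_smul_comm, smul_mul_assoc, mul_assoc]
    abel

lemma cayley_red (hP : ProjFamily P) {E : ℕ+ → ℝ} {L : 𝓗 →L[ℂ] 𝓗} (hL : IsInvH P E L) {T : ℝ}
    {K N G : ℝ → 𝓗 →L[ℂ] 𝓗} (hKs : ∀ t, star (K t) = K t) (hN : ∀ t, BC L (K t) (N t))
    (hKp : ∀ t, K (t + T) = K t) (hK : ContDiff ℝ 1 K)
    (hsm : ∀ t, ‖K t‖ + ‖N t‖ * ‖L‖ < 1) :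
    Red L T G (fun t => 2 * Ring.inverse (1 - Complex.I • K t) - 1)
      (fun t => star (Ring.inverse (1 - Complex.I • K t)) * ((2 * Complex.I) • N t +
        (1 - Complex.I • K t) * G t * (1 + Complex.I • K t) + 2 * deriv K t) *
        Ring.inverse (1 - Complex.I • K t)) ∧
    (∀ t, star (N t) = - N t) := by
  have hn : ∀ t, ‖Complex.I • K t‖ < 1 := fun t => by
    rw [norm_smul, Complex.norm_I, one_mul]
    have := hsm t
    have := mul_nonneg (norm_nonneg (N t)) (norm_nonneg L)
    linarith
  have hIK : ContDiff ℝ 1 fun t => Complex.I • K t := hK.const_smul _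
  have hder := resolvent_deriv hIK fun t => (neumann_basic (hn t)).1
  have hJd : ∀ t, HasDerivAt (fun t => 2 * Ring.inverse (1 - Complex.I • K t) - 1)
      (2 * (Ring.inverse (1 - Complex.I • K t) * (Complex.I • deriv K t) *
        Ring.inverse (1 - Complex.I • K t))) t := by
    intro t
    have := ((hder.1 t).const_mul (2 : 𝓗 →L[ℂ] 𝓗)).sub_const 1
    have e : deriv (fun t => Complex.I • K t) t = Complex.I • deriv K t :=
      ((hK.differentiable one_ne_zero t).hasDerivAt.const_smul Complex.I).deriv
    rw [e] at this
    exact this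
  have main := fun t => cayley_step hP hL (R := Ring.inverse (1 - Complex.I • K t))
    (D := Ring.inverse (1 - (Complex.I • K t + Complex.I • N t * L))) (Kd := deriv K t) (G := G t)
    (hKs t) (hN t) (neumann_basic (hn t)).2.1 (neumann_basic (hn t)).2.2 (by
      have h : ‖Complex.I • K t + Complex.I • N t * L‖ < 1 := by
        refine lt_of_le_of_lt ?_ (hsm t)
        refine (norm_add_le _ _).trans ?_
        rw [norm_smul, Complex.norm_I, one_mul]
        gcongr
        refine (norm_mul_le _ _).trans ?_
        rw [norm_smul, Complex.norm_I, one_mul]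
      have e : 1 - Complex.I • K t + -(Complex.I • N t) * L =
        1 - (Complex.I • K t + Complex.I • N t * L) := by noncomm_ring
      rw [e]
      exact (neumann_basic h).2.2)
  refine ⟨⟨fun t => (main t).2.1, fun t => by simp only [hKp], ?_, fun t => (main t).2.2.1,
    fun t => ?_⟩, fun t => (main t).1⟩
  · exact (contDiff_const.mul hder.2).sub contDiff_const
  · rw [(hJd t).deriv]
    exact (main t).2.2.2

lemma schur_cont (hP : ProjFamily P) {a α r δ x C : ℝ} (hr : 1 < r) (hδ : 0 ≤ δ) (hx : 0 ≤ x)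
    (hC : 0 ≤ C) {z : ℕ+ → ℕ+ → ℂ}
    (hz1 : ∀ m n, ‖z m n‖ * wt a α m n ≤ C * wt r δ m n)
    (hz2 : ∀ m n : ℕ+, ‖z m n‖ ≤ C * jap (((m : ℕ) : ℝ) - ((n : ℕ) : ℝ)))
    {F : ℝ → 𝓗 →L[ℂ] 𝓗} (hF : Continuous F) (hcl : ∀ t, Cls P a α x (F t)) :
    ∃ M : ℝ → 𝓗 →L[ℂ] 𝓗, Continuous M ∧ (∀ t, Cls P r δ (C * x) (M t)) ∧
      ∀ t m n, P m * M t * P n = z m n • (P m * F t * P n) := by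
  have key := fun t => exists_mult hP z (hcl t) hr hδ (y := C * x) (by positivity) (fun m n => by
    have := mul_le_mul_of_nonneg_left (hz1 m n) hx
    nlinarith)
  choose M hM1 hM2 using key
  refine ⟨M, ?_, hM2, hM1⟩
  set θ := (r - 1) / (2 * (r + 1)) with hθ
  have hθ0 : 0 < θ := by rw [hθ]; apply div_pos <;> linarith
  have hθ1 : θ < 1 := by rw [hθ, div_lt_one (by linarith)]; linarith
  have hexp : r - θ * (r + 1) = (r + 1) / 2 := by
    rw [hθ]; field_simp; ring
  have hs : 1 < (r + 1) / 2 := by linarith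
  set Q := (2 * (C * x)) ^ (1 - θ) * C ^ θ with hQ
  have hQ0 : 0 ≤ Q := by positivity
  have bd : ∀ s t, ‖M s - M t‖ ≤ Q * ‖F s - F t‖ ^ θ * Zsum ((r + 1) / 2) := by
    intro s t
    refine Cls.norm_le hP (α := 0) ?_ (by positivity) hs le_rfl
    intro m n
    set j := jap (((m : ℕ) : ℝ) - ((n : ℕ) : ℝ)) with hj
    have hj1 : 0 < j := jap_pos _
    set e := ‖F s - F t‖ with he
    have he0 : 0 ≤ e := norm_nonneg _
    have hw : wt ((r + 1) / 2) 0 m n = j ^ (-((r + 1) / 2)) := by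
      unfold wt
      rw [mul_zero, Real.rpow_zero, mul_one, Real.rpow_neg hj1.le]
    have b1 : ‖P m * (M s - M t) * P n‖ ≤ 2 * (C * x) * j ^ (-r) := by
      have := ((hM2 s).sub (hM2 t)) m n
      refine this.trans ?_
      rw [← two_mul]
      gcongr
      exact wt_le_jap r δ hδ m n
    have b2 : ‖P m * (M s - M t) * P n‖ ≤ C * j * e := by
      have : P m * (M s - M t) * P n = z m n • (P m * (F s - F t) * P n) := by
        rw [mul_sub, sub_mul, hM1, hM1, mul_sub, sub_mul, smul_sub]
      rw [this, norm_smul]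
      have h3 : ‖P m * (F s - F t) * P n‖ ≤ e := by
        calc _ ≤ ‖P m‖ * ‖F s - F t‖ * ‖P n‖ := by
              refine (norm_mul_le _ _).trans ?_
              gcongr
              exact norm_mul_le _ _
          _ ≤ 1 * ‖F s - F t‖ * 1 := by
              gcongr
              · exact PF.norm_le hP m
              · exact PF.norm_le hP n
          _ = e := by rw [one_mul, mul_one]
      exact mul_le_mul (hz2 m n) h3 (norm_nonneg _) (by positivity)
    rw [hw]
    set y := ‖P m * (M s - M t) * P n‖ with hy
    have hy0 : 0 ≤ y := norm_nonneg _
    calc y = y ^ (1 - θ) * y ^ θ := by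
          rw [← Real.rpow_add' hy0 (by norm_num)]; simp
      _ ≤ (2 * (C * x) * j ^ (-r)) ^ (1 - θ) * (C * j * e) ^ θ := by
          gcongr
      _ = Q * e ^ θ * (j ^ (-r * (1 - θ)) * j ^ θ) := by
          rw [Real.mul_rpow (by positivity) (by positivity), Real.mul_rpow (by positivity) he0,
            Real.mul_rpow hC hj1.le, Real.rpow_mul hj1.le]
          ring
      _ = Q * e ^ θ * j ^ (-((r + 1) / 2)) := by
          rw [← Real.rpow_add hj1]
          congr 2
          rw [← hexp]; ring
  rw [continuous_iff_continuousAt]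
  intro t
  rw [ContinuousAt, tendsto_iff_norm_sub_tendsto_zero]
  refine squeeze_zero (fun _ => norm_nonneg _) (fun s => bd s t) ?_
  have : Continuous fun s => Q * ‖F s - F t‖ ^ θ * Zsum ((r + 1) / 2) := by
    refine (continuous_const.mul ?_).mul continuous_const
    exact (hF.sub continuous_const).norm.rpow_const fun _ => Or.inr hθ0.le
  have h := this.tendsto t
  simpa [Real.zero_rpow hθ0.ne'] using h

end neu

set_option linter.unusedSectionVars false
set_option linter.unusedVariables false

/-! ### The anti-adiabatic step -/

section astep
variable {P : ℕ+ → 𝓗 →L[ℂ] 𝓗}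

lemma Cls.smul' {a α x y : ℝ} {A : 𝓗 →L[ℂ] 𝓗} (hA : Cls P a α x A) (z : ℂ) (h : ‖z‖ * x ≤ y) :
    Cls P a α y (z • A) := (hA.smul z).le h

lemma averaging {T : ℝ} (hT : 0 < T) {a α η : ℝ} (hη : 0 ≤ η)
    {B : ℝ → 𝓗 →L[ℂ] 𝓗} (hBp : ∀ t, B (t + T) = B t) (hBs : ∀ t, star (B t) = B t)
    (hBc : Continuous B) (hcl : ∀ t, Cls P a α η (B t)) :
    ∃ (B0 : 𝓗 →L[ℂ] 𝓗) (K : ℝ → 𝓗 →L[ℂ] 𝓗), star B0 = B0 ∧ Cls P a α η B0 ∧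
      (∀ t, K (t + T) = K t) ∧ (∀ t, star (K t) = K t) ∧ ContDiff ℝ 1 K ∧
      (∀ t, deriv K t = (-(1 / 2) : ℂ) • (B t - B0)) ∧
      (∀ t, K t = (-(1 / 2) : ℂ) • ∫ τ in (0 : ℝ)..t, (B τ - B0)) ∧
      ∀ t, Cls P a α (T * η) (K t) := by
  set B0 := ((T : ℂ)⁻¹) • ∫ τ in (0 : ℝ)..T, B τ with hB0
  have hB0s : star B0 = B0 := by
    rw [hB0, star_smul, star_integral hBc hBs]
    simp
  have hB0c : Cls P a α η B0 := by
    refine (Cls.integral hBc hcl 0 T).smul' _ ?_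
    rw [norm_inv, Complex.norm_real, Real.norm_of_nonneg hT.le, sub_zero, abs_of_pos hT,
      inv_mul_cancel_left₀ hT.ne']
  have hFc : Continuous fun t => B t - B0 := hBc.sub continuous_const
  have hFp : Function.Periodic (fun t => B t - B0) T := fun t => by simp only [hBp]
  have hFs : ∀ t, star (B t - B0) = B t - B0 := fun t => by rw [star_sub, hBs, hB0s]
  have hFcl : ∀ t, Cls P a α (2 * η) (B t - B0) := fun t => by
    rw [two_mul]; exact (hcl t).sub hB0c
  have hint0 : ∫ τ in (0 : ℝ)..T, (B τ - B0) = 0 := by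
    rw [intervalIntegral.integral_sub (hBc.intervalIntegrable _ _)
      (continuous_const.intervalIntegrable _ _), intervalIntegral.integral_const, sub_zero,
      ← Complex.coe_smul, hB0, smul_smul, mul_inv_cancel₀ (Complex.ofReal_ne_zero.2 hT.ne'),
      one_smul, sub_self]
  obtain ⟨hd, hcd⟩ := contDiff_integral hFc
  set K : ℝ → 𝓗 →L[ℂ] 𝓗 := fun t => (-(1 / 2) : ℂ) • ∫ τ in (0 : ℝ)..t, (B τ - B0) with hK
  have hKp : Function.Periodic K T := by
    intro t
    simp only [hK]
    congr 1
    rw [← intervalIntegral.integral_add_adjacent_intervals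
      (hFc.intervalIntegrable 0 t) (hFc.intervalIntegrable t (t + T)),
      hFp.intervalIntegral_add_eq t 0, zero_add, hint0, add_zero]
  refine ⟨B0, K, hB0s, hB0c, hKp, fun t => ?_, hcd.const_smul _, fun t => ?_, fun t => rfl,
    fun t => ?_⟩
  · simp only [hK]
    rw [star_smul, star_integral hFc hFs]
    simp
  · exact ((hd t).const_smul (-(1 / 2) : ℂ)).deriv
  · obtain ⟨s, hs, e⟩ := hKp.exists_mem_Ico₀ hT t
    rw [e]
    refine (Cls.integral hFc hFcl 0 s).smul' _ ?_
    rw [sub_zero, abs_of_nonneg hs.1]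
    have : ‖(-(1 / 2) : ℂ)‖ = 1 / 2 := by norm_num
    rw [this]
    nlinarith [hs.2]

lemma gap_mult {E : ℕ+ → ℝ} {γ CH : ℝ} (hCH : 0 ≤ CH) (hγ : 0 ≤ γ)
    (hgap : ∀ m n : ℕ+, |E m - E n| ≤
      CH * |((m : ℕ) : ℝ) - ((n : ℕ) : ℝ)| / (((max m n : ℕ+) : ℕ) : ℝ) ^ (2 * γ))
    (r δ : ℝ) (m n : ℕ+) :
    ‖(E m : ℂ) - (E n : ℂ)‖ * wt (r + 1) (δ - γ) m n ≤ CH * wt r δ m n ∧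
    ‖(E m : ℂ) - (E n : ℂ)‖ ≤ CH * jap (((m : ℕ) : ℝ) - ((n : ℕ) : ℝ)) := by
  have e : ‖(E m : ℂ) - (E n : ℂ)‖ = |E m - E n| := by
    rw [← Complex.ofReal_sub, Complex.norm_real, Real.norm_eq_abs]
  rw [e]
  have h := hgap m n
  set j := jap (((m : ℕ) : ℝ) - ((n : ℕ) : ℝ)) with hj
  set M := (((max m n : ℕ+) : ℕ) : ℝ) with hM
  have hj0 : 0 < j := jap_pos _
  have hM1 : 1 ≤ M := pcast_one_le _
  have hM0 : 0 < M := by linarith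
  have hja : |((m : ℕ) : ℝ) - ((n : ℕ) : ℝ)| ≤ j := abs_le_jap _
  have h' : |E m - E n| ≤ CH * j / M ^ (2 * γ) := h.trans (by gcongr)
  constructor
  · calc |E m - E n| * wt (r + 1) (δ - γ) m n ≤ CH * j / M ^ (2 * γ) * wt (r + 1) (δ - γ) m n := by
          gcongr
          exact (wt_pos _ _ _ _).le
      _ = CH * wt r δ m n := by
          unfold wt
          rw [← hj, ← hM, Real.rpow_add_one hj0.ne']
          have : M ^ (2 * δ) = M ^ (2 * (δ - γ)) * M ^ (2 * γ) := by
            rw [← Real.rpow_add hM0]; congr 1; ring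
          rw [this]
          field_simp
  · refine h'.trans ?_
    apply div_le_self (by positivity)
    exact Real.one_le_rpow hM1 (by linarith)

lemma commutator_family (hP : ProjFamily P) {E : ℕ+ → ℝ} {L : 𝓗 →L[ℂ] 𝓗} (hL : IsInvH P E L)
    {γ CH : ℝ} (hCH : 0 ≤ CH) (hγ : 0 ≤ γ)
    (hgap : ∀ m n : ℕ+, |E m - E n| ≤
      CH * |((m : ℕ) : ℝ) - ((n : ℕ) : ℝ)| / (((max m n : ℕ+) : ℕ) : ℝ) ^ (2 * γ))
    {r δ x y : ℝ} (hr : 1 < r) (hδ : 0 ≤ δ) (hx : 0 ≤ x)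
    {F K : ℝ → 𝓗 →L[ℂ] 𝓗} (hF : Continuous F) (hcl : ∀ t, Cls P (r + 1) (δ - γ) x (F t))
    (hK : ∀ t, K t = (-(1 / 2) : ℂ) • ∫ τ in (0 : ℝ)..t, F τ)
    (hKc : ∀ t, Cls P (r + 1) (δ - γ) y (K t)) :
    ∃ N : ℝ → 𝓗 →L[ℂ] 𝓗, ContDiff ℝ 1 N ∧ (∀ t, BC L (K t) (N t)) ∧
      ∀ t, Cls P r δ (CH * y) (N t) := by
  have hg := gap_mult hCH hγ hgap r δ
  obtain ⟨M, hM, hMc, hMb⟩ := schur_cont hP (a := r + 1) (α := δ - γ) hr hδ hx hCH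
    (z := fun m n => (E m : ℂ) - (E n : ℂ)) (fun m n => (hg m n).1) (fun m n => (hg m n).2) hF hcl
  have hb : ∀ t m n, P m * ((-(1 / 2) : ℂ) • ∫ τ in (0 : ℝ)..t, M τ) * P n =
      ((E m : ℂ) - (E n : ℂ)) • (P m * K t * P n) := by
    intro t m n
    have e : ∫ τ in (0 : ℝ)..t, P m * M τ * P n =
        ((E m : ℂ) - (E n : ℂ)) • ∫ τ in (0 : ℝ)..t, P m * F τ * P n := by
      simp only [hMb]
      exact intervalIntegral.integral_smul _ _
    rw [hK, mul_smul_comm, smul_mul_assoc, blk_integral hM, mul_smul_comm, smul_mul_assoc,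
      blk_integral hF, e, smul_comm]
  refine ⟨fun t => (-(1 / 2) : ℂ) • ∫ τ in (0 : ℝ)..t, M τ,
    (contDiff_integral hM).2.const_smul _, fun t => BC.of_blocks hP hL (hb t), fun t m n => ?_⟩
  rw [hb, norm_smul]
  have hy : 0 ≤ y := by
    have := (norm_nonneg _).trans (hKc 0 1 1)
    exact nonneg_of_mul_nonneg_left this (wt_pos _ _ _ _)
  calc _ ≤ ‖(E m : ℂ) - (E n : ℂ)‖ * (y * wt (r + 1) (δ - γ) m n) := by
        gcongr
        exact hKc t m n
    _ = y * (‖(E m : ℂ) - (E n : ℂ)‖ * wt (r + 1) (δ - γ) m n) := by ring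
    _ ≤ y * (CH * wt r δ m n) := mul_le_mul_of_nonneg_left (hg m n).1 hy
    _ = _ := by ring

/-- The remainder. -/
def Qrem (N W K F : 𝓗 →L[ℂ] 𝓗) : 𝓗 →L[ℂ] 𝓗 :=
  (2 * Complex.I) • N + (2 * Complex.I) • (W * K - K * W) + Complex.I • (F * K - K * F) +
    K * (F * K)

lemma Qrem_eq (N W K F S R : 𝓗 →L[ℂ] 𝓗) (hR : (1 - Complex.I • K) * R = 1)
    (hS : S * (1 + Complex.I • K) = 1) :
    S * ((2 * Complex.I) • N + (1 - Complex.I • K) * (W + F) * (1 + Complex.I • K) +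
      2 * ((-(1 / 2) : ℂ) • F)) * R = W + S * Qrem N W K F * R := by
  have e : (2 * Complex.I) • N + (1 - Complex.I • K) * (W + F) * (1 + Complex.I • K) +
      2 * ((-(1 / 2) : ℂ) • F) =
      (1 + Complex.I • K) * W * (1 - Complex.I • K) + Qrem N W K F := by
    have e2 : (2 : 𝓗 →L[ℂ] 𝓗) * ((-(1 / 2) : ℂ) • F) = - F := by
      rw [two_mul]; module
    have hI : ∀ X : 𝓗 →L[ℂ] 𝓗, Complex.I • Complex.I • X = -X := fun X => by
      rw [smul_smul, Complex.I_mul_I, neg_one_smul]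
    rw [e2]
    unfold Qrem
    simp only [mul_add, add_mul, mul_sub, sub_mul, mul_one, one_mul, smul_mul_assoc,
      mul_smul_comm, smul_add, smul_sub, hI, mul_assoc]
    module
  rw [e, mul_add, add_mul]
  congr 1
  calc _ = (S * (1 + Complex.I • K)) * W * ((1 - Complex.I • K) * R) := by
        simp only [mul_assoc]
    _ = W := by rw [hS, hR, one_mul, mul_one]

lemma Qrem_star {N W K F : 𝓗 →L[ℂ] 𝓗} (hN : star N = -N) (hW : star W = W) (hK : star K = K)
    (hF : star F = F) : star (Qrem N W K F) = Qrem N W K F := by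
  unfold Qrem
  simp only [star_add, star_sub, star_mul, star_smul, hN, hW, hK, hF, Complex.star_def,
    Complex.conj_I, map_mul, mul_assoc]
  have : (starRingEnd ℂ) 2 = 2 := Complex.conj_ofNat 2
  simp only [this]
  module

lemma Qrem_cls (hP : ProjFamily P) {γ r δ ω : ℝ} (hγ : 0 ≤ γ) (hγ2 : γ ≤ 1 / 2) (hr : 1 < r)
    (hδ : 2 * γ ≤ δ) (h1 : r + 2 * δ - 2 * γ ≤ ω) {N W K F : 𝓗 →L[ℂ] 𝓗} {x w f : ℝ}
    (hw0 : 0 ≤ w) (hf0 : 0 ≤ f)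
    (hN : Cls P r δ x N) (hW : Cls P ω γ w W) (hK : Cls P (r + 1) (δ - γ) 1 K)
    (hF : Cls P (r + 1) (δ - γ) f F) :
    Cls P r δ (2 * x + 2 * (Mc r γ (δ - γ) * w + Mc r (δ - γ) γ * w) +
      (Mc r γ γ * f + Mc r γ γ * f) + Mc r 0 γ * (Mc r γ γ * f)) (Qrem N W K F) := by
  have a1 := hW.mul hP r γ (δ - γ) 0 hK hw0 hγ (by linarith) le_rfl (by linarith) (by linarith)
    (by linarith) (by linarith) hr
  have a2 := hK.mul hP r (δ - γ) γ 0 hW zero_le_one (by linarith) hγ le_rfl (by linarith)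
    (by linarith) (by linarith) (by linarith) hr
  have a3 := hF.mul hP r γ γ (δ - 2 * γ) hK hf0 hγ hγ (by linarith) (by linarith) (by linarith)
    (by linarith) (by linarith) hr
  have a4 := hK.mul hP r γ γ (δ - 2 * γ) hF zero_le_one hγ hγ (by linarith) (by linarith)
    (by linarith) (by linarith) (by linarith) hr
  rw [show γ + (δ - γ) + 0 = δ by ring, mul_one] at a1
  rw [show (δ - γ) + γ + 0 = δ by ring, one_mul] at a2
  rw [show γ + γ + (δ - 2 * γ) = δ by ring, mul_one] at a3
  rw [show γ + γ + (δ - 2 * γ) = δ by ring, one_mul] at a4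
  have a5 := hK.mul hP r 0 γ (δ - γ) a3 zero_le_one le_rfl hγ (by linarith) (by linarith)
    (by linarith) (by linarith) (by linarith) hr
  rw [show 0 + γ + (δ - γ) = δ by ring, one_mul] at a5
  have n2 : ‖(2 * Complex.I)‖ = 2 := by simp
  refine (((hN.smul' _ ?_).add ((a1.sub a2).smul' _ ?_)).add ((a3.sub a4).smul' _ ?_)).add a5
  · rw [n2]
  · rw [n2]
  · rw [Complex.norm_I, one_mul]

lemma conj_cls (hP : ProjFamily P) {r δ a α x : ℝ} (hr : 1 < r) (hδ : 0 ≤ δ) (hα : 0 ≤ α)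
    (hαδ : α ≤ δ) (ha : r + 2 * (δ - α) ≤ a) (hx : 0 ≤ x) {Y Z Q : 𝓗 →L[ℂ] 𝓗}
    (hY : Cls P a α 1 (Y - 1)) (hZ : Cls P a α 1 (Z - 1)) (hQ : Cls P r δ x Q) :
    Cls P r δ ((1 + Mc r 0 (δ - α)) * ((1 + Mc r (δ - α) 0) * x)) (Z * Q * Y) := by
  have b1 := hQ.mul hP r (δ - α) 0 α hY hx (by linarith) le_rfl hα (by linarith) (by linarith)
    (by linarith) (by linarith) hr
  rw [show (δ - α) + 0 + α = δ by ring, mul_one] at b1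
  have b2 : Cls P r δ ((1 + Mc r (δ - α) 0) * x) (Q * Y) := by
    have e : Q * Y = Q + Q * (Y - 1) := by noncomm_ring
    rw [e, add_mul, one_mul]
    exact hQ.add b1
  have b3 := hZ.mul hP r 0 (δ - α) α b2 zero_le_one le_rfl (by linarith) hα (by linarith)
    (by linarith) (by linarith) (by linarith) hr
  rw [show 0 + (δ - α) + α = δ by ring, one_mul] at b3
  have e : Z * Q * Y = Q * Y + (Z - 1) * (Q * Y) := by noncomm_ring
  rw [e, add_mul, one_mul]
  exact b2.add b3

lemma anti_step (hP : ProjFamily P) {E : ℕ+ → ℝ} {L : 𝓗 →L[ℂ] 𝓗} (hL : IsInvH P E L)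
    {γ CH T : ℝ} (hCH : 0 ≤ CH) (hγ : 0 ≤ γ) (hγ2 : γ ≤ 1 / 2) (hT : 0 < T)
    (hgap : ∀ m n : ℕ+, |E m - E n| ≤
      CH * |((m : ℕ) : ℝ) - ((n : ℕ) : ℝ)| / (((max m n : ℕ+) : ℕ) : ℝ) ^ (2 * γ))
    {r δ ω : ℝ} (hr : 1 < r) (hδ : 2 * γ ≤ δ) (h1 : r + 2 * δ - 2 * γ ≤ ω)
    (h2 : ω ≤ r + 1 + 2 * (δ - 2 * γ)) :
    ∃ C > 0, ∃ η₀ > 0, ∀ η, 0 ≤ η → η ≤ η₀ → ∀ (W : 𝓗 →L[ℂ] 𝓗) (B : ℝ → 𝓗 →L[ℂ] 𝓗),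
      star W = W → Cls P ω γ η W → (∀ t, B (t + T) = B t) → (∀ t, star (B t) = B t) →
      StrongC1 B → (∀ t, Cls P (r + 1) (δ - γ) η (B t)) →
      ∃ (J : ℝ → 𝓗 →L[ℂ] 𝓗) (W' : 𝓗 →L[ℂ] 𝓗) (B' : ℝ → 𝓗 →L[ℂ] 𝓗),
        Red L T (fun t => W + B t) J (fun t => W' + B' t) ∧ star W' = W' ∧
        Cls P ω γ (C * η) W' ∧ (∀ t, B' (t + T) = B' t) ∧ (∀ t, star (B' t) = B' t) ∧
        StrongC1 B' ∧ ∀ t, Cls P r δ (C * η) (B' t) := by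
  have hr1 : 1 < r + 1 := by linarith
  have p1 := Mc_pos r γ (δ - γ) hr
  have p2 := Mc_pos r (δ - γ) γ hr
  have p3 := Mc_pos r γ γ hr
  have p4 := Mc_pos r 0 γ hr
  have p5 := Mc_pos r γ 0 hr
  have p6 := Mc_pos (r + 1) 0 0 hr1
  have z1 := Zsum_pos r hr
  have z2 := Zsum_pos (r + 1) hr1
  have hLn := norm_nonneg L
  set c1 := 2 * (CH * T) + 2 * (Mc r γ (δ - γ) * 2 + Mc r (δ - γ) γ * 2) +
      (Mc r γ γ * 2 + Mc r γ γ * 2) + Mc r 0 γ * (Mc r γ γ * 2) with hc1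
  have hc1p : 0 < c1 := by positivity
  set c2 := (1 + Mc r 0 γ) * ((1 + Mc r γ 0) * c1) with hc2
  have hc2p : 0 < c2 := by positivity
  set S := T * (2 + 2 * Mc (r + 1) 0 0 + 2 * (Zsum (r + 1) + CH * Zsum r * ‖L‖)) with hS
  have hSp : 0 < S := by positivity
  refine ⟨2 + c2, by positivity, 1 / S, by positivity, ?_⟩
  intro η hη0 hη W B hWs hW hBp hBs hB hBc
  have hSη : S * η ≤ 1 := by
    rw [le_div_iff₀ hSp] at hη; linarith
  have hTη : 0 ≤ T * η := by positivity
  have q1 : 0 ≤ Mc (r + 1) 0 0 * (T * η) := by positivity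
  have q2 : 0 ≤ (Zsum (r + 1) + CH * Zsum r * ‖L‖) * (T * η) := by positivity
  have q3 : 2 * (T * η) + 2 * (Mc (r + 1) 0 0 * (T * η)) +
      2 * ((Zsum (r + 1) + CH * Zsum r * ‖L‖) * (T * η)) ≤ 1 := by
    rw [hS] at hSη; linarith
  obtain ⟨B0, K, hB0s, hB0c, hKp, hKs, hKd, hKdd, hKi, hKc⟩ :=
    averaging hT hη0 hBp hBs hB.continuous hBc
  have hFcl : ∀ t, Cls P (r + 1) (δ - γ) (2 * η) (B t - B0) := fun t => by
    rw [two_mul]; exact (hBc t).sub hB0c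
  obtain ⟨N, hNd, hN, hNc⟩ := commutator_family hP hL hCH hγ hgap hr (by linarith)
    (by positivity : 0 ≤ 2 * η) (hB.continuous.sub continuous_const) hFcl hKi hKc
  have hsm : ∀ t, ‖K t‖ + ‖N t‖ * ‖L‖ < 1 := by
    intro t
    have k1 := (hKc t).norm_le hP hTη hr1 (by linarith)
    have k2 := (hNc t).norm_le hP (by positivity) hr (by linarith)
    have k3 := mul_le_mul_of_nonneg_right k2 hLn
    have e : T * η * Zsum (r + 1) + CH * (T * η) * Zsum r * ‖L‖ =
      (Zsum (r + 1) + CH * Zsum r * ‖L‖) * (T * η) := by ring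
    linarith
  have hnI : ∀ t, ‖Complex.I • K t‖ < 1 := fun t => by
    rw [norm_smul, Complex.norm_I, one_mul]
    have := hsm t
    have := mul_nonneg (norm_nonneg (N t)) hLn
    linarith
  obtain ⟨hred, hNs⟩ := cayley_red hP hL (G := fun t => W + B t) hKs hN hKp hKd hsm
  set R : ℝ → 𝓗 →L[ℂ] 𝓗 := fun t => Ring.inverse (1 - Complex.I • K t) with hR
  have hR1 : ∀ t, (1 - Complex.I • K t) * R t = 1 := fun t => (neumann_basic (hnI t)).2.2
  have hRs : ∀ t, star (R t) * (1 + Complex.I • K t) = 1 := by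
    intro t
    have := congrArg star (hR1 t)
    rw [star_mul, star_sub, star_smul, star_one, hKs, Complex.star_def, Complex.conj_I, neg_smul,
      sub_neg_eq_add] at this
    exact this
  have hRc : ∀ t, Cls P (r + 1) (δ - γ) 1 (R t - 1) := by
    intro t
    have hIK : Cls P (r + 1) (δ - γ) (T * η) (Complex.I • K t) :=
      (hKc t).smul' _ (by rw [Complex.norm_I, one_mul])
    exact (neumann_cls hP hIK hTη hr1 (by linarith) (by linarith) (hnI t)).le (by linarith)
  have hRsc : ∀ t, Cls P (r + 1) (δ - γ) 1 (star (R t) - 1) := by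
    intro t
    have := (hRc t).star hP
    rwa [star_sub, star_one] at this
  have hRd : ContDiff ℝ 1 R :=
    (resolvent_deriv (hKd.const_smul Complex.I) fun t => (neumann_basic (hnI t)).1).2
  have hW'c : Cls P ω γ (η + η) (W + B0) :=
    hW.add (hB0c.mono hη0 le_rfl (by linarith) (by linarith))
  have hW's : star (W + B0) = W + B0 := by rw [star_add, hWs, hB0s]
  have hK1 : ∀ t, Cls P (r + 1) (δ - γ) 1 (K t) := fun t => (hKc t).le (by linarith)
  refine ⟨fun t => 2 * R t - 1, W + B0, fun t => star (R t) * Qrem (N t) (W + B0) (K t) (B t - B0) * R t, ?_, hW's,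
    ?_, ?_, ?_, ?_, ?_⟩
  · have e : (fun t => W + B0 + star (R t) * Qrem (N t) (W + B0) (K t) (B t - B0) * R t) =
        fun t => star (R t) * ((2 * Complex.I) • N t +
          (1 - Complex.I • K t) * (W + B t) * (1 + Complex.I • K t) + 2 * deriv K t) * R t := by
      funext t
      rw [← Qrem_eq _ _ _ _ _ _ (hR1 t) (hRs t), hKdd]
      have e2 : W + B0 + (B t - B0) = W + B t := by abel
      rw [e2]
    change Red L T (fun t => W + B t) (fun t => 2 * R t - 1)
      (fun t => W + B0 + star (R t) * Qrem (N t) (W + B0) (K t) (B t - B0) * R t)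
    rw [e]
    exact hred
  · refine hW'c.le ?_
    have := mul_nonneg hc2p.le hη0
    linarith
  · intro t
    have hNp : N (t + T) = N t := by
      have := hN (t + T)
      rw [hKp] at this
      exact BC.unique hP hL this (hN t)
    simp only [hR, hKp, hBp, hNp]
  · intro t
    rw [star_mul, star_mul, star_star, Qrem_star (hNs t) hW's (hKs t) (by
      rw [star_sub, hBs, hB0s])]
    exact (mul_assoc _ _ _).symm
  · have sK := StrongC1.of_contDiff hKd
    have sN := StrongC1.of_contDiff hNd
    have sR := StrongC1.of_contDiff hRd
    have sRs := StrongC1.of_contDiff (contDiff_star_op hRd)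
    have sW := StrongC1.const (W + B0)
    have sF := hB.sub (StrongC1.const B0)
    exact (sRs.mul ((((sN.smul _).add (((sW.mul sK).sub (sK.mul sW)).smul _)).add
      (((sF.mul sK).sub (sK.mul sF)).smul _)).add (sK.mul (sF.mul sK)))).mul sR
  · intro t
    have h := Qrem_cls hP hγ hγ2 hr hδ h1 (w := 2 * η) (f := 2 * η) (by positivity) (by positivity)
      (hNc t) (by rw [two_mul]; exact hW'c) (hK1 t) (hFcl t)
    have h := conj_cls hP hr (by linarith) (by linarith) (by linarith) (by linarith)
      (by positivity) (hRc t) (hRsc t) h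
    refine h.le ?_
    rw [show δ - (δ - γ) = γ by ring]
    have : (1 + Mc r 0 γ) * ((1 + Mc r γ 0) * (2 * (CH * (T * η)) + 2 * (Mc r γ (δ - γ) * (2 * η) +
      Mc r (δ - γ) γ * (2 * η)) + (Mc r γ γ * (2 * η) + Mc r γ γ * (2 * η)) +
      Mc r 0 γ * (Mc r γ γ * (2 * η)))) = c2 * η := by rw [hc2, hc1]; ring
    rw [this]
    linarith

end astep

set_option linter.unusedSectionVars false
set_option linter.unusedVariables false

/-! ### Diagonalization of the time-independent part -/

section diag
variable {P : ℕ+ → 𝓗 →L[ℂ] 𝓗}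

lemma mult_cls {a α x b β κ : ℝ} {A B : 𝓗 →L[ℂ] 𝓗} {z : ℕ+ → ℕ+ → ℂ} (hx : 0 ≤ x)
    (hB : ∀ m n, P m * B * P n = z m n • (P m * A * P n)) (hA : Cls P a α x A)
    (hz : ∀ m n, ‖z m n‖ * wt a α m n ≤ κ * wt b β m n) : Cls P b β (κ * x) B := by
  intro m n
  rw [hB, norm_smul]
  calc _ ≤ ‖z m n‖ * (x * wt a α m n) := by
        gcongr
        exact hA m n
    _ = x * (‖z m n‖ * wt a α m n) := by ring
    _ ≤ x * (κ * wt b β m n) := mul_le_mul_of_nonneg_left (hz m n) hx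
    _ = _ := by ring

lemma exists_mult_fun (hP : ProjFamily P) {a α b β κ : ℝ} (z : ℕ+ → ℕ+ → ℂ) (hb : 1 < b)
    (hβ : 0 ≤ β) (hκ : 0 ≤ κ) (hz : ∀ m n, ‖z m n‖ * wt a α m n ≤ κ * wt b β m n) :
    ∃ f : (𝓗 →L[ℂ] 𝓗) → (𝓗 →L[ℂ] 𝓗), ∀ X, (∃ x, 0 ≤ x ∧ Cls P a α x X) →
      ∀ m n, P m * f X * P n = z m n • (P m * X * P n) := by
  have : ∀ X : 𝓗 →L[ℂ] 𝓗, ∃ Y : 𝓗 →L[ℂ] 𝓗, (∃ x, 0 ≤ x ∧ Cls P a α x X) →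
      ∀ m n, P m * Y * P n = z m n • (P m * X * P n) := by
    intro X
    by_cases h : ∃ x, 0 ≤ x ∧ Cls P a α x X
    · obtain ⟨x, hx, hX⟩ := h
      obtain ⟨Y, hY, -⟩ := exists_mult hP z hX hb hβ (y := κ * x) (by positivity) (fun m n => by
        have := mul_le_mul_of_nonneg_left (hz m n) hx
        nlinarith)
      exact ⟨Y, fun _ => hY⟩
    · exact ⟨0, fun h' => absurd h' h⟩
  choose f hf using this
  exact ⟨f, hf⟩

lemma fixed_pt (hP : ProjFamily P) {ω γ ρ : ℝ} (hω : 1 < ω) (hγ : 0 ≤ γ) (hρ : 0 ≤ ρ)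
    (Φ : (𝓗 →L[ℂ] 𝓗) → (𝓗 →L[ℂ] 𝓗)) (h0 : Cls P ω γ (ρ / 2) (Φ 0))
    (hc : ∀ X X' d, 0 ≤ d → Cls P ω γ ρ X → Cls P ω γ ρ X' → Cls P ω γ d (X - X') →
      Cls P ω γ (d / 2) (Φ X - Φ X'))
    (hs : ∀ X, Cls P ω γ ρ X → star X = X → star (Φ X) = Φ X) :
    ∃ X, Cls P ω γ ρ X ∧ Φ X = X ∧ star X = X := by
  let Y : ℕ → 𝓗 →L[ℂ] 𝓗 := fun n => Φ^[n] 0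
  have hYs : ∀ n, Y (n + 1) = Φ (Y n) := fun n => Function.iterate_succ_apply' Φ n 0
  have z0 : Cls P ω γ ρ (0 : 𝓗 →L[ℂ] 𝓗) := (Cls.zero (P := P)).le hρ
  have hYc : ∀ n, Cls P ω γ ρ (Y n) := by
    intro n
    induction n with
    | zero => exact z0
    | succ k ih =>
      rw [hYs]
      have := (hc (Y k) 0 ρ hρ ih z0 (by rwa [sub_zero])).add h0
      rw [sub_add_cancel, add_halves] at this
      exact this
  have hYst : ∀ n, star (Y n) = Y n := by
    intro n
    induction n with
    | zero => exact star_zero _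
    | succ k ih => rw [hYs]; exact hs _ (hYc k) ih
  have hd : ∀ n k, Cls P ω γ (ρ * (1 / 2) ^ n) (Y (n + k) - Y n) := by
    intro n
    induction n with
    | zero =>
      intro k
      rw [pow_zero, mul_one, zero_add]
      have : Y 0 = 0 := rfl
      rw [this, sub_zero]
      exact hYc k
    | succ j ih =>
      intro k
      have := hc _ _ _ (by positivity) (hYc (j + k)) (hYc j) (ih k)
      rw [← hYs, ← hYs] at this
      rw [show j + 1 + k = j + k + 1 by ring]
      refine this.le (le_of_eq ?_)
      rw [pow_succ]; ring
  have hz := Zsum_pos ω hω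
  have hcau : CauchySeq Y := by
    refine cauchySeq_of_le_geometric (1 / 2) (ρ * Zsum ω) (by norm_num) fun n => ?_
    rw [dist_comm, dist_eq_norm]
    refine ((hd n 1).norm_le hP (by positivity) hω hγ).trans (le_of_eq ?_)
    ring
  obtain ⟨X, hX⟩ := cauchySeq_tendsto_of_complete hcau
  have hXc : Cls P ω γ ρ X := Cls.lim hYc hX
  have hXd : ∀ n, Cls P ω γ (ρ * (1 / 2) ^ n) (X - Y n) := by
    intro n
    have h1 : Filter.Tendsto (fun k => Y (n + k)) Filter.atTop (nhds X) := by
      have := (Filter.tendsto_add_atTop_iff_nat n).2 hX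
      simpa only [add_comm] using this
    exact Cls.lim (hd n) (h1.sub_const _)
  refine ⟨X, hXc, ?_, ?_⟩
  · have h1 : Filter.Tendsto (fun n => Y (n + 1)) Filter.atTop (nhds X) :=
      (Filter.tendsto_add_atTop_iff_nat 1).2 hX
    refine tendsto_nhds_unique ?_ h1
    rw [tendsto_iff_norm_sub_tendsto_zero]
    have hb : ∀ n, ‖Y (n + 1) - Φ X‖ ≤ (ρ * Zsum ω) * (1 / 2) ^ n := by
      intro n
      rw [norm_sub_rev, hYs]
      have := hc _ _ _ (by positivity) hXc (hYc n) (hXd n)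
      refine (this.norm_le hP (by positivity) hω hγ).trans ?_
      have : 0 ≤ ρ * Zsum ω * (1 / 2) ^ n := by positivity
      linarith
    refine squeeze_zero (fun _ => norm_nonneg _) hb ?_
    have := (tendsto_pow_atTop_nhds_zero_of_lt_one (r := (1 / 2 : ℝ)) (by norm_num)
      (by norm_num)).const_mul (ρ * Zsum ω)
    rwa [mul_zero] at this
  · have h1 : Filter.Tendsto (fun n => star (Y n)) Filter.atTop (nhds (star X)) := hX.star
    simp only [hYst] at h1
    exact tendsto_nhds_unique h1 hX

/-- The map whose fixed point diagonalizes. -/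
def Phi (W K A : 𝓗 →L[ℂ] 𝓗) : 𝓗 →L[ℂ] 𝓗 :=
  W + Complex.I • (W * K - K * W) + K * (W * K) - Complex.I • (K * A - A * K) - K * (A * K)

lemma Phi_star {W K A : 𝓗 →L[ℂ] 𝓗} (hW : star W = W) (hK : star K = K) (hA : star A = A) :
    star (Phi W K A) = Phi W K A := by
  unfold Phi
  simp only [star_add, star_sub, star_mul, star_smul, hW, hK, hA, Complex.star_def,
    Complex.conj_I, mul_assoc]
  module

lemma Phi_diff (W K A K' A' : 𝓗 →L[ℂ] 𝓗) :
    Phi W K A - Phi W K' A' =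
      Complex.I • (W * (K - K') - (K - K') * W) + ((K - K') * (W * K) + K' * (W * (K - K'))) -
      Complex.I • (((K - K') * A + K' * (A - A')) - (A * (K - K') + (A - A') * K')) -
      ((K - K') * (A * K) + K' * ((A - A') * K) + K' * (A' * (K - K'))) := by
  unfold Phi
  simp only [mul_sub, sub_mul, smul_sub, smul_add, mul_assoc]
  abel

lemma Phi_diff_cls (hP : ProjFamily P) {ω γ : ℝ} (hω : 1 < ω) (hγ : 0 ≤ γ) (hγ2 : γ ≤ 1 / 2)
    {W K A K' A' : 𝓗 →L[ℂ] 𝓗} {κ η ρ d M : ℝ} (hκ : 0 ≤ κ) (hη : 0 ≤ η) (hρ : 0 ≤ ρ) (hd : 0 ≤ d)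
    (hM : M = Mc ω γ 0 + Mc ω 0 γ) (hηρ : η ≤ ρ) (hs : M * κ * ρ ≤ 1 / 14)
    (hW : Cls P ω γ η W) (hK : Cls P (ω + 1) 0 (κ * ρ) K) (hK' : Cls P (ω + 1) 0 (κ * ρ) K')
    (hA : Cls P ω γ ρ A) (hA' : Cls P ω γ ρ A')
    (hD : Cls P (ω + 1) 0 (κ * d) (K - K')) (hF : Cls P ω γ d (A - A')) :
    Cls P ω γ (d / 2) (Phi W K A - Phi W K' A') := by
  have p1 := Mc_pos ω γ 0 hω
  have p2 := Mc_pos ω 0 γ hω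
  have hM0 : 0 ≤ M := by rw [hM]; positivity
  have mL : ∀ {X Y : 𝓗 →L[ℂ] 𝓗} {x y : ℝ}, 0 ≤ x → 0 ≤ y → Cls P (ω + 1) 0 x X → Cls P ω γ y Y →
      Cls P ω γ (M * (x * y)) (X * Y) := by
    intro X Y x y hx hy hX hY
    have := hX.mul hP ω 0 γ 0 hY hx le_rfl hγ le_rfl (by linarith) (by linarith) (by linarith)
      (by linarith) hω
    rw [zero_add, add_zero] at this
    refine this.le ?_
    gcongr
    rw [hM]; linarith
  have mR : ∀ {X Y : 𝓗 →L[ℂ] 𝓗} {x y : ℝ}, 0 ≤ x → 0 ≤ y → Cls P ω γ y Y → Cls P (ω + 1) 0 x X →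
      Cls P ω γ (M * (y * x)) (Y * X) := by
    intro X Y x y hx hy hY hX
    have := hY.mul hP ω γ 0 0 hX hy hγ le_rfl le_rfl (by linarith) (by linarith) (by linarith)
      (by linarith) hω
    rw [add_zero, add_zero] at this
    refine this.le ?_
    gcongr
    rw [hM]; linarith
  have hκρ : 0 ≤ κ * ρ := by positivity
  have hκd : 0 ≤ κ * d := by positivity
  rw [Phi_diff]
  have t1 := (mR hκd hη hW hD).sub (mL hκd hη hD hW)
  have t2 := (mL hκd (by positivity) hD (mR hκρ hη hW hK)).add
    (mL hκρ (by positivity) hK' (mR hκd hη hW hD))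
  have t3 := ((mL hκd hρ hD hA).add (mL hκρ hd hK' hF)).sub
    ((mR hκd hρ hA hD).add (mR hκρ hd hF hK'))
  have t4 := ((mL hκd (by positivity) hD (mR hκρ hρ hA hK)).add
    (mL hκρ (by positivity) hK' (mR hκρ hd hF hK))).add
    (mL hκρ (by positivity) hK' (mR hκd hρ hA' hD))
  have n1 : ∀ x : ℝ, ‖Complex.I‖ * x ≤ x := fun x => by rw [Complex.norm_I, one_mul]
  refine ((((t1.smul' Complex.I (n1 _)).add t2).sub (t3.smul' Complex.I (n1 _))).sub t4).le ?_
  set s := M * κ * ρ with hsdef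
  set u := M * κ * η with hudef
  have hs0 : 0 ≤ s := by positivity
  have hu0 : 0 ≤ u := by positivity
  have hus : u ≤ s := by rw [hsdef, hudef]; gcongr
  have key : 2 * u + 2 * (u * s) + 4 * s + 3 * (s * s) ≤ 1 / 2 := by nlinarith
  have := mul_le_mul_of_nonneg_right key hd
  refine le_trans (le_of_eq ?_) (this.trans (le_of_eq (by ring)))
  rw [hsdef, hudef]
  ring

lemma gap_inv {E : ℕ+ → ℝ} {γ cH : ℝ} (hcH : 0 < cH)
    (hgap : ∀ m n : ℕ+, cH * |((m : ℕ) : ℝ) - ((n : ℕ) : ℝ)| / (((max m n : ℕ+) : ℕ) : ℝ) ^ (2 * γ)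
      ≤ |E m - E n|) (ω : ℝ) (m n : ℕ+) :
    ‖if m = n then (0 : ℂ) else Complex.I / (2 * ((E m : ℂ) - (E n : ℂ)))‖ * wt ω γ m n ≤
      (1 / (2 * cH)) * wt (ω + 1) 0 m n := by
  split_ifs with h
  · rw [norm_zero, zero_mul]
    have := wt_pos (ω + 1) 0 m n
    positivity
  · have e : ‖(E m : ℂ) - (E n : ℂ)‖ = |E m - E n| := by
      rw [← Complex.ofReal_sub, Complex.norm_real, Real.norm_eq_abs]
    rw [norm_div, Complex.norm_I, norm_mul, e, Complex.norm_ofNat]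
    have hg := hgap m n
    have hj1 : 1 ≤ |((m : ℕ) : ℝ) - ((n : ℕ) : ℝ)| := by
      have h1 : ((m : ℕ) : ℤ) - ((n : ℕ) : ℤ) ≠ 0 := by
        intro h2
        apply h
        apply PNat.coe_injective
        omega
      have := Int.one_le_abs h1
      have h3 : ((1 : ℤ) : ℝ) ≤ ((|((m : ℕ) : ℤ) - ((n : ℕ) : ℤ)| : ℤ) : ℝ) := by exact_mod_cast this
      push_cast at h3
      exact h3
    have hje : jap (((m : ℕ) : ℝ) - ((n : ℕ) : ℝ)) = |((m : ℕ) : ℝ) - ((n : ℕ) : ℝ)| :=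
      max_eq_right hj1
    unfold wt
    rw [hje]
    set j := |((m : ℕ) : ℝ) - ((n : ℕ) : ℝ)| with hj
    set M := (((max m n : ℕ+) : ℕ) : ℝ) with hMdef
    have hM1 : 1 ≤ M := pcast_one_le _
    have hM0 : 0 < M := by linarith
    have hj0 : 0 < j := by linarith
    have hMp : 0 < M ^ (2 * γ) := Real.rpow_pos_of_pos hM0 _
    have hl : 0 < cH * j / M ^ (2 * γ) := by positivity
    have hp : 0 < (j ^ ω * M ^ (2 * γ))⁻¹ := by positivity
    calc 1 / (2 * |E m - E n|) * (j ^ ω * M ^ (2 * γ))⁻¹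
        ≤ 1 / (2 * (cH * j / M ^ (2 * γ))) * (j ^ ω * M ^ (2 * γ))⁻¹ := by gcongr
      _ = _ := by
        rw [Real.rpow_add_one hj0.ne', mul_zero, Real.rpow_zero]
        have : 0 < j ^ ω := Real.rpow_pos_of_pos hj0 _
        field_simp

lemma Red.add_conj {L : 𝓗 →L[ℂ] 𝓗} {T : ℝ} {V J G : ℝ → 𝓗 →L[ℂ] 𝓗} (h : Red L T V J G)
    (B : ℝ → 𝓗 →L[ℂ] 𝓗) :
    Red L T (fun t => V t + B t) J (fun t => G t + star (J t) * B t * J t) where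
  unit := h.unit
  per := h.per
  smooth := h.smooth
  bc := h.bc
  eq t := by
    obtain ⟨C, hC, e⟩ := h.eq t
    refine ⟨C, hC, ?_⟩
    have a := (h.unit t).1
    have e2 : J t * (G t + star (J t) * B t * J t) * star (J t) =
        J t * G t * star (J t) + B t := by
      calc _ = J t * G t * star (J t) + (J t * star (J t)) * B t * (J t * star (J t)) := by
            noncomm_ring
        _ = _ := by rw [a, one_mul, mul_one]
    rw [e2, e]
    abel

lemma diag_step (hP : ProjFamily P) {E : ℕ+ → ℝ} {L : 𝓗 →L[ℂ] 𝓗} (hL : IsInvH P E L)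
    (hEinj : Function.Injective E)
    {γ cH : ℝ} (T : ℝ) (hcH : 0 < cH) (hγ : 0 ≤ γ) (hγ2 : γ ≤ 1 / 2)
    (hgap : ∀ m n : ℕ+, cH * |((m : ℕ) : ℝ) - ((n : ℕ) : ℝ)| / (((max m n : ℕ+) : ℕ) : ℝ) ^ (2 * γ)
      ≤ |E m - E n|) {ω : ℝ} (hω : 1 < ω) :
    ∃ η > 0, ∀ W : 𝓗 →L[ℂ] 𝓗, star W = W → Cls P ω γ η W →
      ∃ U A : 𝓗 →L[ℂ] 𝓗, Red L T (fun _ => W) (fun _ => U) (fun _ => A) ∧ star A = A ∧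
        IsDiag P A ∧ Cls P (ω + 1) 0 1 (U - 1) := by
  have hω1 : 1 < ω + 1 := by linarith
  have p1 := Mc_pos ω γ 0 hω
  have p2 := Mc_pos ω 0 γ hω
  have p6 := Mc_pos (ω + 1) 0 0 hω1
  have z1 := Zsum_pos ω hω
  have z2 := Zsum_pos (ω + 1) hω1
  have hLn := norm_nonneg L
  set M := Mc ω γ 0 + Mc ω 0 γ with hM
  set κ := 1 / (2 * cH) with hκ
  have hκ0 : 0 < κ := by positivity
  set S := 14 * (M * κ) + 4 * κ + 2 * Mc (ω + 1) 0 0 * κ +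
    2 * (κ * Zsum (ω + 1) + Zsum ω * ‖L‖) with hS
  have hM0 : 0 < M := by positivity
  have hSp : 0 < S := by positivity
  set ρ := 1 / S with hρ
  have hρ0 : 0 < ρ := by positivity
  have hSρ : S * ρ = 1 := by rw [hρ]; field_simp
  have s1 : 0 < M * κ * ρ := by positivity
  have s2 : 0 < κ * ρ := by positivity
  have s3 : 0 < Mc (ω + 1) 0 0 * (κ * ρ) := by positivity
  have s4 : 0 ≤ (κ * Zsum (ω + 1) + Zsum ω * ‖L‖) * ρ := by positivity
  have s5 : 14 * (M * κ * ρ) + 4 * (κ * ρ) + 2 * (Mc (ω + 1) 0 0 * (κ * ρ)) +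
      2 * ((κ * Zsum (ω + 1) + Zsum ω * ‖L‖) * ρ) = 1 := by
    refine Eq.trans ?_ hSρ
    rw [hS]; ring
  refine ⟨ρ / 2, by positivity, fun W hWs hW => ?_⟩
  set zK : ℕ+ → ℕ+ → ℂ := fun m n =>
    if m = n then (0 : ℂ) else Complex.I / (2 * ((E m : ℂ) - (E n : ℂ))) with hzK
  set zA : ℕ+ → ℕ+ → ℂ := fun m n => if m = n then (1 : ℂ) else 0 with hzA
  have hzKb : ∀ m n, ‖zK m n‖ * wt ω γ m n ≤ κ * wt (ω + 1) 0 m n := fun m n =>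
    gap_inv hcH hgap ω m n
  have hzAb : ∀ m n, ‖zA m n‖ * wt ω γ m n ≤ 1 * wt ω γ m n := fun m n => by
    have := (wt_pos ω γ m n).le
    simp only [hzA]
    split_ifs
    · simp
    · simpa using this
  obtain ⟨Kf, hKf⟩ := exists_mult_fun hP zK hω1 le_rfl hκ0.le hzKb
  obtain ⟨Af, hAf⟩ := exists_mult_fun hP zA hω hγ zero_le_one hzAb
  have hKd : ∀ {X X' : 𝓗 →L[ℂ] 𝓗} {d}, 0 ≤ d → Cls P ω γ ρ X → Cls P ω γ ρ X' →
      Cls P ω γ d (X - X') → Cls P (ω + 1) 0 (κ * d) (Kf X - Kf X') := by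
    intro X X' d hd hX hX' h
    refine mult_cls hd (fun m n => ?_) h hzKb
    rw [mul_sub, sub_mul, hKf X ⟨ρ, hρ0.le, hX⟩, hKf X' ⟨ρ, hρ0.le, hX'⟩, mul_sub, sub_mul,
      smul_sub]
  have hAd : ∀ {X X' : 𝓗 →L[ℂ] 𝓗} {d}, 0 ≤ d → Cls P ω γ ρ X → Cls P ω γ ρ X' →
      Cls P ω γ d (X - X') → Cls P ω γ d (Af X - Af X') := by
    intro X X' d hd hX hX' h
    rw [← one_mul d]
    refine mult_cls hd (fun m n => ?_) h hzAb
    rw [mul_sub, sub_mul, hAf X ⟨ρ, hρ0.le, hX⟩, hAf X' ⟨ρ, hρ0.le, hX'⟩, mul_sub, sub_mul,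
      smul_sub]
  have hKc : ∀ {X : 𝓗 →L[ℂ] 𝓗}, Cls P ω γ ρ X → Cls P (ω + 1) 0 (κ * ρ) (Kf X) := fun hX =>
    mult_cls hρ0.le (hKf _ ⟨ρ, hρ0.le, hX⟩) hX hzKb
  have hAc : ∀ {X : 𝓗 →L[ℂ] 𝓗}, Cls P ω γ ρ X → Cls P ω γ ρ (Af X) := fun hX => by
    have := mult_cls hρ0.le (hAf _ ⟨ρ, hρ0.le, hX⟩) hX hzAb
    rwa [one_mul] at this
  have hblk : ∀ (Y : 𝓗 →L[ℂ] 𝓗) m n, P m * star Y * P n = star (P n * Y * P m) := by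
    intro Y m n
    rw [star_mul, star_mul, PF.star hP, PF.star hP, mul_assoc]
  have hKs : ∀ {X : 𝓗 →L[ℂ] 𝓗}, Cls P ω γ ρ X → star X = X → star (Kf X) = Kf X := by
    intro X hX hXs
    refine PF.ext hP fun m n => ?_
    have hb := hKf X ⟨ρ, hρ0.le, hX⟩
    rw [hblk, hb, hb, star_smul, ← hblk, hXs]
    congr 1
    simp only [hzK]
    by_cases h : m = n
    · subst h; simp
    · rw [if_neg h, if_neg (Ne.symm h)]
      rw [← Complex.ofReal_sub, ← Complex.ofReal_sub]
      rw [Complex.star_def, map_div₀, map_mul, Complex.conj_I, Complex.conj_ofReal]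
      have : (starRingEnd ℂ) 2 = 2 := Complex.conj_ofNat 2
      rw [this, ← neg_sub (E n) (E m), Complex.ofReal_neg, mul_neg, div_neg, neg_div]
  have hAs : ∀ {X : 𝓗 →L[ℂ] 𝓗}, Cls P ω γ ρ X → star X = X → star (Af X) = Af X := by
    intro X hX hXs
    refine PF.ext hP fun m n => ?_
    have hb := hAf X ⟨ρ, hρ0.le, hX⟩
    rw [hblk, hb, hb, star_smul, ← hblk, hXs]
    congr 1
    simp only [hzA]
    by_cases h : m = n
    · subst h; simp
    · rw [if_neg h, if_neg (Ne.symm h), star_zero]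
  have z0 : Cls P ω γ 0 (0 : 𝓗 →L[ℂ] 𝓗) := Cls.zero
  have zr : Cls P ω γ ρ (0 : 𝓗 →L[ℂ] 𝓗) := z0.le hρ0.le
  have hK0 : Kf 0 = 0 := by
    refine PF.ext hP fun m n => ?_
    rw [hKf 0 ⟨0, le_rfl, z0⟩]; simp
  have hA0 : Af 0 = 0 := by
    refine PF.ext hP fun m n => ?_
    rw [hAf 0 ⟨0, le_rfl, z0⟩]; simp
  obtain ⟨X, hX, hfix, hXs⟩ := fixed_pt hP hω hγ hρ0.le (fun X => Phi W (Kf X) (Af X))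
    (by simp only [hK0, hA0, Phi]; simpa using hW)
    (fun X X' d hd hX hX' h => Phi_diff_cls hP hω hγ hγ2 hκ0.le (by positivity) hρ0.le hd hM
      (by linarith : ρ / 2 ≤ ρ) (by linarith) hW (hKc hX) (hKc hX') (hAc hX) (hAc hX')
      (hKd hd hX hX' h) (hAd hd hX hX' h))
    (fun X hX hXs => Phi_star hWs (hKs hX hXs) (hAs hX hXs))
  set K := Kf X with hKX
  set A := Af X with hAX
  have hKb := hKf X ⟨ρ, hρ0.le, hX⟩
  have hAb := hAf X ⟨ρ, hρ0.le, hX⟩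
  set N := (Complex.I / 2) • (X - A) with hN
  have hBC : BC L K N := by
    refine BC.of_blocks hP hL fun m n => ?_
    rw [hN, mul_smul_comm, smul_mul_assoc, mul_sub, sub_mul, hAb, hKb]
    simp only [hzA, hzK]
    by_cases h : m = n
    · subst h; simp
    · rw [if_neg h, if_neg h, zero_smul, sub_zero, smul_smul]
      congr 1
      have : (E m : ℂ) - (E n : ℂ) ≠ 0 := by
        rw [← Complex.ofReal_sub]
        exact Complex.ofReal_ne_zero.2 (sub_ne_zero.2 fun h' => h (hEinj h'))
      field_simp
  have hNc : Cls P ω γ ρ N := by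
    refine (hX.sub (hAc hX)).smul' _ ?_
    rw [norm_div, Complex.norm_I, Complex.norm_ofNat]
    linarith
  have hsm : ‖K‖ + ‖N‖ * ‖L‖ < 1 := by
    have k1 := (hKc hX).norm_le hP s2.le hω1 le_rfl
    have k2 := hNc.norm_le hP hρ0.le hω hγ
    have k3 := mul_le_mul_of_nonneg_right k2 hLn
    have e : κ * ρ * Zsum (ω + 1) + ρ * Zsum ω * ‖L‖ =
      (κ * Zsum (ω + 1) + Zsum ω * ‖L‖) * ρ := by ring
    linarith
  have hnI : ‖Complex.I • K‖ < 1 := by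
    rw [norm_smul, Complex.norm_I, one_mul]
    have := mul_nonneg (norm_nonneg N) hLn
    linarith
  obtain ⟨hred, -⟩ := cayley_red hP hL (T := T) (K := fun _ => K) (N := fun _ => N)
    (G := fun _ => W) (fun _ => hKs hX hXs) (fun _ => hBC) (fun _ => rfl) contDiff_const
    (fun _ => hsm)
  set R := Ring.inverse (1 - Complex.I • K) with hR
  have hR1 : (1 - Complex.I • K) * R = 1 := (neumann_basic hnI).2.2
  have hRs : star R * (1 + Complex.I • K) = 1 := by
    have := congrArg star hR1
    rw [star_mul, star_sub, star_smul, star_one, hKs hX hXs, Complex.star_def, Complex.conj_I,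
      neg_smul, sub_neg_eq_add] at this
    exact this
  refine ⟨2 * R - 1, A, ?_, hAs hX hXs, ?_, ?_⟩
  · have e : star R * ((2 * Complex.I) • N + (1 - Complex.I • K) * W * (1 + Complex.I • K) +
        2 * (0 : 𝓗 →L[ℂ] 𝓗)) * R = A := by
      have hI : ∀ X : 𝓗 →L[ℂ] 𝓗, Complex.I • Complex.I • X = -X := fun X => by
        rw [smul_smul, Complex.I_mul_I, neg_one_smul]
      have e2 : (2 * Complex.I) • N = -(X - A) := by
        rw [hN, smul_smul]
        have : (2 * Complex.I) * (Complex.I / 2) = -1 := by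
          rw [← Complex.I_mul_I]; ring
        rw [this, neg_one_smul]
      have e3 : (2 * Complex.I) • N + (1 - Complex.I • K) * W * (1 + Complex.I • K) +
          2 * (0 : 𝓗 →L[ℂ] 𝓗) = (1 + Complex.I • K) * A * (1 - Complex.I • K) := by
        rw [e2, mul_zero, add_zero]
        nth_rewrite 1 [← hfix]
        simp only [Phi]
        simp only [mul_add, add_mul, mul_sub, sub_mul, mul_one, one_mul, smul_mul_assoc,
          mul_smul_comm, smul_add, smul_sub, hI, mul_assoc]
        abel
      rw [e3]
      calc _ = (star R * (1 + Complex.I • K)) * A * ((1 - Complex.I • K) * R) := by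
            simp only [mul_assoc]
        _ = A := by rw [hRs, hR1, one_mul, mul_one]
    simp only [deriv_const] at hred
    rw [e] at hred
    exact hred
  · intro m n h
    have := hAb m n
    simp only [hzA, if_neg h, zero_smul] at this
    rw [mul_assoc] at this
    exact this
  · have hIK : Cls P (ω + 1) 0 (κ * ρ) (Complex.I • K) :=
      (hKc hX).smul' _ (by rw [Complex.norm_I, one_mul])
    have h := neumann_cls hP hIK s2.le hω1 le_rfl (by linarith) hnI
    have e : 2 * R - 1 - 1 = (R - 1) + (R - 1) := by noncomm_ring
    rw [e]
    exact (h.add h).le (by linarith)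

end diag

set_option linter.unusedSectionVars false
set_option linter.unusedVariables false

/-! ### Induction and conclusion -/

section concl
variable {P : ℕ+ → 𝓗 →L[ℂ] 𝓗}

lemma reduce_induct (hP : ProjFamily P) {E : ℕ+ → ℝ} {L : 𝓗 →L[ℂ] 𝓗} (hL : IsInvH P E L)
    {γ CH T : ℝ} (hCH : 0 ≤ CH) (hγ : 0 ≤ γ) (hγ2 : γ ≤ 1 / 2) (hT : 0 < T)
    (hgap : ∀ m n : ℕ+, |E m - E n| ≤
      CH * |((m : ℕ) : ℝ) - ((n : ℕ) : ℝ)| / (((max m n : ℕ+) : ℕ) : ℝ) ^ (2 * γ))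
    {p : ℝ} (j : ℕ) (hj : (j : ℝ) < p - 1) :
    ∀ η > 0, ∃ ε > 0, ∀ V : ℝ → 𝓗 →L[ℂ] 𝓗,
      (∀ t, V (t + T) = V t) → (∀ t, star (V t) = V t) → StrongC1 V →
      (∀ t, Cls P p γ ε (V t)) →
      ∃ (J : ℝ → 𝓗 →L[ℂ] 𝓗) (W : 𝓗 →L[ℂ] 𝓗) (B : ℝ → 𝓗 →L[ℂ] 𝓗),
        Red L T V J (fun t => W + B t) ∧ star W = W ∧
        Cls P (p - j + 1 + 2 * ((j : ℝ) - 1) * γ) γ η W ∧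
        (∀ t, B (t + T) = B t) ∧ (∀ t, star (B t) = B t) ∧
        StrongC1 B ∧ ∀ t, Cls P (p - j) (((j : ℝ) + 1) * γ) η (B t) := by
  induction j with
  | zero =>
    intro η hη
    refine ⟨η, hη, fun V h1 h2 h3 h4 => ⟨fun _ => 1, 0, V, ?_, star_zero _, ?_, h1, h2, h3, ?_⟩⟩
    · simpa using Red.refl L T V
    · exact Cls.zero.le hη.le
    · simpa using h4
  | succ j ih =>
    intro η hη
    push_cast at hj ⊢
    obtain ⟨C, hC, η₀, hη₀, hstep⟩ := anti_step hP hL hCH hγ hγ2 hT hgap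
      (r := p - j - 1) (δ := ((j : ℝ) + 2) * γ) (ω := p - j + 2 * j * γ)
      (by linarith) (by nlinarith [(Nat.cast_nonneg j : (0 : ℝ) ≤ j)]) (by linarith) (by linarith)
    have hm : 0 < min η₀ (η / C) := lt_min hη₀ (by positivity)
    obtain ⟨ε, hε, hI⟩ := ih (by linarith) (min η₀ (η / C)) hm
    refine ⟨ε, hε, fun V h1 h2 h3 h4 => ?_⟩
    obtain ⟨J, W, B, a1, a2, a3, a4, a5, a6, a7⟩ := hI V h1 h2 h3 h4
    obtain ⟨J', W', B', b1, b2, b3, b4, b5, b6, b7⟩ := hstep _ hm.le (min_le_left _ _) W B a2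
      (a3.mono hm.le le_rfl le_rfl (by nlinarith)) a4 a5 a6 (fun t => by
        rw [show p - j - 1 + 1 = p - j by ring,
          show ((j : ℝ) + 2) * γ - γ = ((j : ℝ) + 1) * γ by ring]
        exact a7 t)
    have hle : C * min η₀ (η / C) ≤ η := by
      calc C * min η₀ (η / C) ≤ C * (η / C) := by gcongr; exact min_le_right _ _
        _ = η := by field_simp
    refine ⟨_, W', B', a1.comp b1, b2, ?_, b4, b5, b6, fun t => ?_⟩
    · rw [show p - ((j : ℝ) + 1) + 1 + 2 * ((j : ℝ) + 1 - 1) * γ = p - j + 2 * j * γ by ring]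
      exact b3.le hle
    · rw [show p - ((j : ℝ) + 1) = p - j - 1 by ring,
        show ((j : ℝ) + 1 + 1) * γ = ((j : ℝ) + 2) * γ by ring]
      exact (b7 t).le hle

lemma reduce_final (hP : ProjFamily P) {E : ℕ+ → ℝ} {L : 𝓗 →L[ℂ] 𝓗} (hL : IsInvH P E L)
    (hEinj : Function.Injective E)
    {γ cH CH T : ℝ} (hcH : 0 < cH) (hCH : 0 ≤ CH) (hγ : 0 ≤ γ) (hγ2 : γ < 1 / 2) (hT : 0 < T)
    (hlow : ∀ m n : ℕ+,
      cH * |((m : ℕ) : ℝ) - ((n : ℕ) : ℝ)| / (((max m n : ℕ+) : ℕ) : ℝ) ^ (2 * γ) ≤ |E m - E n|)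
    (hgap : ∀ m n : ℕ+, |E m - E n| ≤
      CH * |((m : ℕ) : ℝ) - ((n : ℕ) : ℝ)| / (((max m n : ℕ+) : ℕ) : ℝ) ^ (2 * γ))
    {p : ℝ} (q : ℕ) (hq : (q : ℝ) < p - 1) :
    ∃ ε > 0, ∀ V : ℝ → 𝓗 →L[ℂ] 𝓗,
      (∀ t, V (t + T) = V t) → (∀ t, star (V t) = V t) → StrongC1 V →
      (∀ t, Cls P p γ ε (V t)) →
      ∃ (J : ℝ → 𝓗 →L[ℂ] 𝓗) (A : 𝓗 →L[ℂ] 𝓗) (B : ℝ → 𝓗 →L[ℂ] 𝓗),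
        Red L T V J (fun t => A + B t) ∧ star A = A ∧ IsDiag P A ∧
        (∀ t, B (t + T) = B t) ∧ (∀ t, star (B t) = B t) ∧
        StrongC1 B ∧ ∃ b, ∀ t, Cls P (p - q) (((q : ℝ) + 1) * γ) b (B t) := by
  have hq0 : (0 : ℝ) ≤ q := Nat.cast_nonneg q
  have hqγ : 0 ≤ (q : ℝ) * γ := mul_nonneg hq0 hγ
  obtain ⟨η, hη, hD⟩ := diag_step hP hL hEinj T hcH hγ hγ2.le hlow
    (ω := p - q + 1 + 2 * ((q : ℝ) - 1) * γ) (by nlinarith)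
  obtain ⟨ε, hε, hI⟩ := reduce_induct hP hL hCH hγ hγ2.le hT hgap q hq η hη
  refine ⟨ε, hε, fun V h1 h2 h3 h4 => ?_⟩
  obtain ⟨J, W, B, a1, a2, a3, a4, a5, a6, a7⟩ := hI V h1 h2 h3 h4
  obtain ⟨U, A, c1, c2, c3, c4⟩ := hD W a2 a3
  refine ⟨_, A, fun t => star U * B t * U, a1.comp (c1.add_conj B), c2, c3, ?_, ?_, ?_, _,
    fun t => conj_cls hP (a := p - q + 1 + 2 * ((q : ℝ) - 1) * γ + 1) (α := 0) (by linarith)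
      (by nlinarith) le_rfl (by nlinarith) (by nlinarith) hη.le c4 ?_ (a7 t)⟩
  · intro t; simp only [a4]
  · intro t; simp only [star_mul, star_star, a5, mul_assoc]
  · exact ((StrongC1.const (star U)).mul a6).mul (StrongC1.const U)
  · have h := c4.star hP
    rwa [star_sub, star_one] at h

end concl

/-- Theorem 3.1: anti-adiabatic reduction of the Floquet Hamiltonian
`K = D + H + V(t)` to `D + H + A + B(t)` with `A` diagonal and `B` in a better class. -/
theorem statement2
    (P : ℕ+ → 𝓗 →L[ℂ] 𝓗) (hP : ProjFamily P)
    (E : ℕ+ → ℝ) (hE1 : 0 < E 1) (hEmono : StrictMono E)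
    (γ cH CH : ℝ) (hγ0 : 0 < γ) (hγh : γ < 1 / 2) (hcH : 0 < cH) (hcC : cH ≤ CH)
    (hgap : ∀ m n : ℕ+,
      cH * |((m : ℕ) : ℝ) - ((n : ℕ) : ℝ)| / (((max m n : ℕ+) : ℕ) : ℝ) ^ (2 * γ)
          ≤ |E m - E n| ∧
      |E m - E n|
          ≤ CH * |((m : ℕ) : ℝ) - ((n : ℕ) : ℝ)| / (((max m n : ℕ+) : ℕ) : ℝ) ^ (2 * γ))
    (p : ℝ) (hp : 2 < p) (q : ℕ) (hq : (q : ℝ) < p - 1) (T : ℝ) (hT : 0 < T) :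
    ∃ ε > 0, ∀ V : ℝ → 𝓗 →L[ℂ] 𝓗,
      (∀ t, V (t + T) = V t) →
      (∀ t, IsSelfAdjoint (V t)) →
      StrongC1 V →
      (∀ (t : ℝ) (m n : ℕ+), wnorm P p γ (V t) m n ≤ ε) →
      ∃ (J : ℝ → 𝓗 →L[ℂ] 𝓗) (A : 𝓗 →L[ℂ] 𝓗) (B : ℝ → 𝓗 →L[ℂ] 𝓗),
        (∀ t, IsUnitaryOp (J t)) ∧ (∀ t, J (t + T) = J t) ∧ StrongC1 J ∧
        IsSelfAdjoint A ∧ IsDiag P A ∧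
        (∀ t, B (t + T) = B t) ∧ (∀ t, IsSelfAdjoint (B t)) ∧ StrongC1 B ∧
        (∃ b : ℝ, ∀ (t : ℝ) (m n : ℕ+),
          wnorm P (p - q) (((q : ℝ) + 1) * γ) (B t) m n ≤ b) ∧
        (∀ t : ℝ, ⇑(star (J t)) '' HDom P E = HDom P E) ∧
        (∀ t : ℝ, ∀ ψ ∈ HDom P E, ∀ h₁ h₂ : 𝓗,
          IsHSum P E ψ h₁ → IsHSum P E (star (J t) ψ) h₂ →
          h₁ + V t ψ =
            J t (h₂ + A (star (J t) ψ) + B t (star (J t) ψ)) +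
              Complex.I • deriv (fun τ => J τ (star (J t) ψ)) t) := by


  obtain ⟨L, hL⟩ := exists_invH hP E hE1 hEmono
  obtain ⟨ε, hε, hF⟩ := reduce_final hP hL hEmono.injective hcH (hcH.le.trans hcC) hγ0.le hγh hT
    (fun m n => (hgap m n).1) (fun m n => (hgap m n).2) q hq
  refine ⟨ε, hε, fun V h1 h2 h3 h4 => ?_⟩
  obtain ⟨J, A, B, hR, a1, a2, a3, a4, a5, b, a6⟩ := hF V h1 (fun t => h2 t) h3
    (fun t => cls_of_wnorm.1 (h4 t))
  refine ⟨J, A, B, hR.unit, hR.per, StrongC1.of_contDiff hR.smooth, a1, a2, a3, a4, a5,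
    ⟨b, fun t => cls_of_wnorm.2 (a6 t)⟩, ?_, ?_⟩
  · intro t
    obtain ⟨C, hC, -⟩ := hR.eq t
    obtain ⟨C', hC'⟩ := hR.bc t
    exact dom_image hP hL hC hC' (hR.unit t).2
  · intro t ψ hψ k₁ k₂ H1 H2
    obtain ⟨C, hC, hV⟩ := hR.eq t
    have hd : HasDerivAt J (deriv J t) t :=
      (hR.smooth.differentiable one_ne_zero t).hasDerivAt
    rw [(hasDerivAt_apply_op hd (star (J t) ψ)).deriv,
      final_eq hP hL hC (hR.unit t).1 hV ψ k₁ k₂ H1 H2, ContinuousLinearMap.add_apply, add_assoc]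

end
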